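/- arXiv:1806.06325 — 3 statements merged into one kernel-verified Lean document; each statement's English description precedes it below -/
import Mathlib

section
/- Let L ≥ 2 and let E(θ,φ) = Σ_{l=2}^{L} Σ_{m=−l}^{l} E_{lm} Y_{lm}(θ,φ) with complex coefficients E_{lm}, where by convention E_{lm} = 0 whenever l < 2, l > L, or |m| > l. Fix a real amplitude A and angles Θ ∈ [0,π], Φ ∈ [0,2π), and define Ē(θ,φ) = E(θ,φ)·(1 + A(cos Θ cos θ + sin Θ sin θ cos(φ−Φ))). Then for every l ≥ 0 and −l ≤ m ≤ l, the coefficient Ē_{lm} := ∫ Ē · conj(Y_{lm}) dΩ equals E_{lm} + A cos Θ·[√(((l+1)²−m²)/((2l+1)(2l+3)))·E_{l+1,m} + √((l²−m²)/((2l−1)(2l+1)))·E_{l−1,m}] + (A sin Θ/2)·e^{−iΦ}·[√(((l−m+1)(l−m+2))/((2l+1)(2l+3)))·E_{l+1,m−1} − √(((l+m−1)(l+m))/((2l−1)(2l+1)))·E_{l−1,m−1}] + (A sin Θ/2)·e^{iΦ}·[√(((l−m−1)(l−m))/((2l−1)(2l+1)))·E_{l−1,m+1} − √(((l+m+1)(l+m+2))/((2l+1)(2l+3)))·E_{l+1,m+1}].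 In particular, the dipole modulation correlates multipoles l and l ± 1 only. -/
open scoped Real
open Complex

noncomputable section

/-- Legendre polynomial `P_l` via Rodrigues' formula. -/
def legendreP (l : ℕ) (x : ℝ) : ℝ :=
  (1 / (2 ^ l * (Nat.factorial l : ℝ))) * iteratedDeriv l (fun y => (y ^ 2 - 1) ^ l) x

/-- Associated Legendre function `P_l^m` for `0 ≤ m ≤ l`. -/
def assocLegendreNat (l m : ℕ) (x : ℝ) : ℝ :=
  (-1 : ℝ) ^ m * (Real.sqrt (1 - x ^ 2)) ^ m * iteratedDeriv m (legendreP l) x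

/-- Associated Legendre function `P_l^m` for integer `m`
    (negative `m` via `P_l^{-m} = (-1)^m ((l-m)!/(l+m)!) P_l^m`). -/
def assocLegendre (l : ℕ) (m : ℤ) (x : ℝ) : ℝ :=
  if 0 ≤ m then assocLegendreNat l m.toNat x
  else
    (-1 : ℝ) ^ m.natAbs *
      ((Nat.factorial (l - m.natAbs) : ℝ) / (Nat.factorial (l + m.natAbs) : ℝ)) *
      assocLegendreNat l m.natAbs x

/-- Spherical harmonic `Y_{lm}(θ,φ)`; by convention it is `0` when `l < 0` or `|m| > l`. -/
def sphHarm (l m : ℤ) (θ φ : ℝ) : ℂ :=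
  if 0 ≤ l ∧ |m| ≤ l then
    ((Real.sqrt ((2 * (l : ℝ) + 1) / (4 * Real.pi) *
        ((Nat.factorial (l - m).toNat : ℝ) / (Nat.factorial (l + m).toNat : ℝ))) *
      assocLegendre l.toNat m (Real.cos θ) : ℝ) : ℂ) *
      Complex.exp (Complex.I * (m : ℂ) * (φ : ℂ))
  else 0

/-- Spin-weighted spherical harmonic `Y_{s,lm}(θ,φ)`;
    by convention it is `0` when `l < |s|` or `|m| > l`. -/
def spinSphHarm (s l m : ℤ) (θ φ : ℝ) : ℂ :=
  if |s| ≤ l ∧ |m| ≤ l then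
    ((Real.sqrt ((2 * (l : ℝ) + 1) / (4 * Real.pi) *
          ((Nat.factorial (l + m).toNat : ℝ) * (Nat.factorial (l - m).toNat : ℝ)) /
          ((Nat.factorial (l + s).toNat : ℝ) * (Nat.factorial (l - s).toNat : ℝ))) *
        Real.sin (θ / 2) ^ (2 * l).toNat : ℝ) : ℂ) *
      Complex.exp (Complex.I * (m : ℂ) * (φ : ℂ)) *
      ∑ r ∈ Finset.Icc (0 : ℤ) (l - s),
        if 0 ≤ r + s - m ∧ r + s - m ≤ l + s then
          ((((l - s).toNat.choose r.toNat : ℝ) * ((l + s).toNat.choose (r + s - m).toNat : ℝ) : ℝ) : ℂ) *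
            (-1 : ℂ) ^ (l - r - s) * ((((Real.tan (θ / 2))⁻¹ : ℝ) ^ (2 * r + s - m) : ℝ) : ℂ)
        else 0
  else 0

/-- Integral of a function over the sphere: `∫ f dΩ = ∫₀^{2π} ∫₀^π f(θ,φ) sin θ dθ dφ`. -/
def sphereIntegral (f : ℝ → ℝ → ℂ) : ℂ :=
  ∫ φ in (0 : ℝ)..(2 * Real.pi), ∫ θ in (0 : ℝ)..Real.pi, f θ φ * ((Real.sin θ : ℝ) : ℂ)

/-- The spin-raising operator `ð` acting on a function of spin weight `s`:
    `ð η = -(sin θ)^s (∂_θ + (i / sin θ) ∂_φ) ((sin θ)^{-s} η)`. -/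
def eth (s : ℤ) (η : ℝ → ℝ → ℂ) : ℝ → ℝ → ℂ := fun θ φ =>
  -(((Real.sin θ : ℝ) : ℂ) ^ s) *
    (deriv (fun t => (((Real.sin t : ℝ) : ℂ) ^ (-s)) * η t φ) θ +
      (Complex.I / ((Real.sin θ : ℝ) : ℂ)) *
        deriv (fun p => (((Real.sin θ : ℝ) : ℂ) ^ (-s)) * η θ p) φ)

/-- The spin-lowering operator `ð̄` acting on a function of spin weight `s`:
    `ð̄ η = -(sin θ)^{-s} (∂_θ - (i / sin θ) ∂_φ) ((sin θ)^s η)`. -/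
def ethBar (s : ℤ) (η : ℝ → ℝ → ℂ) : ℝ → ℝ → ℂ := fun θ φ =>
  -(((Real.sin θ : ℝ) : ℂ) ^ (-s)) *
    (deriv (fun t => (((Real.sin t : ℝ) : ℂ) ^ s) * η t φ) θ -
      (Complex.I / ((Real.sin θ : ℝ) : ℂ)) *
        deriv (fun p => (((Real.sin θ : ℝ) : ℂ) ^ s) * η θ p) φ)

end

section LegendrePolynomials

open Polynomial

lemma iterate_derivative_succ_X_mul {R : Type*} [CommRing R] (n : ℕ) (p : R[X]) :
    derivative^[n + 1] (X * p) =
      X * derivative^[n + 1] p + ((n : R[X]) + 1) * derivative^[n] p := by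
  induction n with
  | zero => simp; ring
  | succ n ih =>
    rw [Function.iterate_succ_apply', ih, Function.iterate_succ_apply' _ (n + 1) p,
      Function.iterate_succ_apply' _ n p]
    simp [derivative_mul]
    ring

/-- The normalised power `(X² - 1)ˡ / (2ˡ l!)` of Rodrigues' formula. -/
noncomputable def rodriguesPoly (l : ℕ) : ℝ[X] :=
  C (1 / (2 ^ l * (Nat.factorial l : ℝ))) * (X ^ 2 - 1) ^ l

/-- The Legendre polynomial as an element of `ℝ[X]`. -/
noncomputable def legendrePoly (l : ℕ) : ℝ[X] := derivative^[l] (rodriguesPoly l)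

lemma C_rodrigues_normalization (l : ℕ) :
    C (1 / (2 ^ (l + 1) * (Nat.factorial (l + 1) : ℝ))) * (2 * ((l : ℝ[X]) + 1)) =
      C (1 / (2 ^ l * (Nat.factorial l : ℝ))) := by
  have : (2 * ((l : ℝ[X]) + 1)) = C (2 * ((l : ℝ) + 1)) := by simp [map_ofNat]
  rw [this, ← C_mul, Nat.factorial_succ]
  congr 1
  push_cast
  field_simp
  ring

lemma derivative_rodriguesPoly_succ (l : ℕ) :
    derivative (rodriguesPoly (l + 1)) = X * rodriguesPoly l := by
  have h := C_rodrigues_normalization l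
  simp only [rodriguesPoly, derivative_C_mul, derivative_pow_succ, derivative_sub, derivative_one]
  rw [← h]
  simp
  ring

lemma two_mul_succ_mul_rodriguesPoly_succ (l : ℕ) :
    2 * ((l : ℝ[X]) + 1) * rodriguesPoly (l + 1) = (X ^ 2 - 1) * rodriguesPoly l := by
  have h := C_rodrigues_normalization l
  simp only [rodriguesPoly]
  rw [← h]
  ring

lemma legendrePoly_zero : legendrePoly 0 = 1 := by
  simp [legendrePoly, rodriguesPoly]

lemma legendrePoly_one : legendrePoly 1 = X := by
  have h := derivative_rodriguesPoly_succ 0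
  simpa [legendrePoly, rodriguesPoly] using h

lemma derivative_iterate_rodriguesPoly (l : ℕ) :
    derivative (derivative^[l] (rodriguesPoly (l + 1))) = legendrePoly (l + 1) := by
  rw [legendrePoly, Function.iterate_succ_apply']

lemma legendrePoly_add_two_sub (l : ℕ) :
    legendrePoly (l + 2) - legendrePoly l =
      (2 * (l : ℝ[X]) + 3) * derivative^[l] (rodriguesPoly (l + 1)) := by
  have h : derivative (derivative (rodriguesPoly (l + 2))) =
      ((2 * l + 3 : ℕ) : ℝ[X]) * rodriguesPoly (l + 1) + rodriguesPoly l := by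
    rw [derivative_rodriguesPoly_succ, derivative_mul, derivative_rodriguesPoly_succ, derivative_X]
    push_cast
    linear_combination -two_mul_succ_mul_rodriguesPoly_succ l
  rw [legendrePoly, Function.iterate_succ_apply, Function.iterate_succ_apply, h,
    iterate_map_add, iterate_derivative_natCast_mul, legendrePoly]
  push_cast
  ring

lemma legendrePoly_add_two (l : ℕ) :
    legendrePoly (l + 2) = X * legendrePoly (l + 1) +
      ((l : ℝ[X]) + 1) * derivative^[l] (rodriguesPoly (l + 1)) := by
  rw [legendrePoly, Function.iterate_succ_apply, derivative_rodriguesPoly_succ,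
    iterate_derivative_succ_X_mul, legendrePoly]

lemma derivative_legendrePoly_add_two_sub (l : ℕ) :
    derivative (legendrePoly (l + 2)) - derivative (legendrePoly l) =
      (2 * (l : ℝ[X]) + 3) * legendrePoly (l + 1) := by
  rw [← derivative_sub, legendrePoly_add_two_sub, derivative_mul,
    derivative_iterate_rodriguesPoly]
  simp

lemma iterate_derivative_legendrePoly_succ (l k : ℕ) :
    (2 * (l : ℝ[X]) + 3) * derivative^[k] (legendrePoly (l + 1)) =
      derivative^[k + 1] (legendrePoly (l + 2)) - derivative^[k + 1] (legendrePoly l) := by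
  have h := congrArg (derivative^[k]) (derivative_legendrePoly_add_two_sub l)
  have e : (2 * (l : ℝ[X]) + 3) = ((2 * l + 3 : ℕ) : ℝ[X]) := by push_cast; ring
  rw [e, iterate_derivative_natCast_mul, iterate_derivative_sub] at h
  rw [e, ← h, Function.iterate_succ_apply, Function.iterate_succ_apply]

lemma X_mul_legendrePoly_succ (l : ℕ) :
    (2 * (l : ℝ[X]) + 3) * (X * legendrePoly (l + 1)) =
      ((l : ℝ[X]) + 2) * legendrePoly (l + 2) + ((l : ℝ[X]) + 1) * legendrePoly l := by
  linear_combination (-(2 * (l : ℝ[X]) + 3)) * legendrePoly_add_two l +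
    ((l : ℝ[X]) + 1) * legendrePoly_add_two_sub l

lemma X_mul_iterate_derivative_legendrePoly_succ (l k : ℕ) :
    (2 * (l : ℝ[X]) + 3) * (X * derivative^[k] (legendrePoly (l + 1))) =
      ((l : ℝ[X]) + 2 - (k : ℝ[X])) * derivative^[k] (legendrePoly (l + 2)) +
        ((l : ℝ[X]) + 1 + (k : ℝ[X])) * derivative^[k] (legendrePoly l) := by
  cases k with
  | zero => simpa using X_mul_legendrePoly_succ l
  | succ k =>
    have h := congrArg (derivative^[k + 1]) (X_mul_legendrePoly_succ l)
    have e₁ : (2 * (l : ℝ[X]) + 3) = ((2 * l + 3 : ℕ) : ℝ[X]) := by push_cast; ring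
    have e₂ : ((l : ℝ[X]) + 2) = ((l + 2 : ℕ) : ℝ[X]) := by push_cast; ring
    have e₃ : ((l : ℝ[X]) + 1) = ((l + 1 : ℕ) : ℝ[X]) := by push_cast; ring
    rw [e₁, e₂, e₃, iterate_map_add, iterate_derivative_natCast_mul,
      iterate_derivative_natCast_mul, iterate_derivative_natCast_mul,
      iterate_derivative_succ_X_mul] at h
    push_cast at h ⊢
    linear_combination h - ((k : ℝ[X]) + 1) * iterate_derivative_legendrePoly_succ l k

lemma one_sub_X_sq_mul_derivative_legendrePoly (l : ℕ) :
    (1 - X ^ 2) * derivative (legendrePoly (l + 1)) =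
      ((l : ℝ[X]) + 1) * (legendrePoly l - X * legendrePoly (l + 1)) := by
  have h₂ (l : ℕ) : derivative (legendrePoly (l + 1)) =
      ((l : ℝ[X]) + 1) * legendrePoly l + X * derivative (legendrePoly l) := by
    cases l with
    | zero => simp [legendrePoly_zero, legendrePoly_one]
    | succ l =>
      rw [legendrePoly_add_two, derivative_add, derivative_mul, derivative_mul,
        derivative_iterate_rodriguesPoly]
      simp
      ring
  have h₁ := derivative_legendrePoly_add_two_sub l
  have h₃ := h₂ (l + 1)
  push_cast at h₃
  linear_combination h₂ l + X * (h₃ - h₁)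

lemma one_sub_X_sq_mul_iterate_derivative_legendrePoly (l k : ℕ) :
    (2 * (l : ℝ[X]) + 3) * ((1 - X ^ 2) * derivative^[k + 1] (legendrePoly (l + 1))) =
      ((l : ℝ[X]) + (k : ℝ[X]) + 2) * ((l : ℝ[X]) + (k : ℝ[X]) + 1) * derivative^[k] (legendrePoly l) -
        ((l : ℝ[X]) - (k : ℝ[X]) + 1) * ((l : ℝ[X]) - (k : ℝ[X]) + 2) * derivative^[k] (legendrePoly (l + 2)) := by
  induction k with
  | zero =>
    have h₁ := one_sub_X_sq_mul_derivative_legendrePoly l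
    have h₂ := X_mul_legendrePoly_succ l
    simp only [Function.iterate_succ, Function.iterate_zero, Function.comp, id]
    push_cast
    linear_combination (2 * (l : ℝ[X]) + 3) * h₁ - ((l : ℝ[X]) + 1) * h₂
  | succ k ih =>
    have h := congrArg derivative ih
    have h₂ := X_mul_iterate_derivative_legendrePoly_succ l (k + 1)
    simp only [Function.iterate_succ_apply' _ (k + 1), Function.iterate_succ_apply' _ k] at h h₂ ⊢
    simp only [derivative_mul, derivative_sub, derivative_add, derivative_natCast,
      derivative_ofNat, derivative_one, derivative_X_pow, map_ofNat, Nat.cast_ofNat] at h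
    push_cast at h h₂ ⊢
    linear_combination h + 2 * h₂

lemma legendrePoly_ode (l k : ℕ) :
    (1 - X ^ 2) * derivative^[k + 2] (legendrePoly l) -
      2 * ((k : ℝ[X]) + 1) * X * derivative^[k + 1] (legendrePoly l) +
      ((l : ℝ[X]) - (k : ℝ[X])) * ((l : ℝ[X]) + (k : ℝ[X]) + 1) * derivative^[k] (legendrePoly l) = 0 := by
  cases l with
  | zero =>
    rw [legendrePoly_zero]
    cases k <;> simp [iterate_derivative_one]
  | succ l =>
    have h := congrArg derivative (one_sub_X_sq_mul_iterate_derivative_legendrePoly l k)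
    have h₁ := X_mul_iterate_derivative_legendrePoly_succ l (k + 1)
    have h₂ := iterate_derivative_legendrePoly_succ l k
    have ne : (2 * (l : ℝ[X]) + 3) ≠ 0 := by
      have : (2 * (l : ℝ[X]) + 3) = ((2 * l + 3 : ℕ) : ℝ[X]) := by push_cast; ring
      rw [this]
      exact Nat.cast_ne_zero.mpr (by omega)
    apply mul_left_cancel₀ ne
    simp only [Function.iterate_succ_apply' _ (k + 1), Function.iterate_succ_apply' _ k]
      at h h₁ h₂ ⊢
    simp only [derivative_mul, derivative_sub, derivative_add, derivative_natCast,
      derivative_ofNat, derivative_one, derivative_X_pow, map_ofNat, Nat.cast_ofNat] at h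
    push_cast at h h₁ h₂ ⊢
    linear_combination h - 2 * k * h₁ + ((l : ℝ[X]) + 1 - k) * (l + k + 2) * h₂

lemma natDegree_legendrePoly_le (l : ℕ) : (legendrePoly l).natDegree ≤ l := by
  refine (natDegree_iterate_derivative _ _).trans ?_
  have : (rodriguesPoly l).natDegree ≤ 2 * l := by
    refine (natDegree_C_mul_le _ _).trans (natDegree_pow_le.trans ?_)
    have : (X ^ 2 - 1 : ℝ[X]).natDegree ≤ 2 := by compute_degree
    nlinarith
  omega

lemma iterate_derivative_legendrePoly_eq_zero {l k : ℕ} (h : l < k) :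
    derivative^[k] (legendrePoly l) = 0 :=
  iterate_derivative_eq_zero ((natDegree_legendrePoly_le l).trans_lt h)

lemma iteratedDeriv_polynomial_eval (n : ℕ) (p : ℝ[X]) :
    iteratedDeriv n (fun x => p.eval x) = fun x => (derivative^[n] p).eval x := by
  induction n with
  | zero => simp
  | succ n ih =>
    rw [iteratedDeriv_succ, ih, Function.iterate_succ_apply']
    ext x
    exact Polynomial.deriv _

lemma legendreP_eq_eval (l : ℕ) : legendreP l = fun x => (legendrePoly l).eval x := by
  have h : (fun y : ℝ => (y ^ 2 - 1) ^ l) = fun y => ((X ^ 2 - 1 : ℝ[X]) ^ l).eval y := by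
    ext y; simp
  ext x
  rw [legendreP, h, iteratedDeriv_polynomial_eval, legendrePoly, rodriguesPoly,
    iterate_derivative_C_mul, eval_mul, eval_C]

lemma assocLegendreNat_cos (l k : ℕ) {θ : ℝ} (h : 0 ≤ Real.sin θ) :
    assocLegendreNat l k (Real.cos θ) =
      (-1) ^ k * Real.sin θ ^ k * (derivative^[k] (legendrePoly l)).eval (Real.cos θ) := by
  rw [assocLegendreNat, legendreP_eq_eval, iteratedDeriv_polynomial_eval,
    ← Real.abs_sin_eq_sqrt_one_sub_cos_sq, abs_of_nonneg h]

end LegendrePolynomials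

section LegendreOrthogonality

open Polynomial

lemma integral_derivative_eval (p : ℝ[X]) :
    ∫ x in (-1 : ℝ)..1, (derivative p).eval x = p.eval 1 - p.eval (-1) :=
  intervalIntegral.integral_eq_sub_of_hasDerivAt (fun x _ => p.hasDerivAt x)
    ((derivative p).continuous.intervalIntegrable _ _)

/-- Integration over `[-1, 1]` as a linear functional on polynomials. -/
noncomputable def polyIntegral : ℝ[X] →ₗ[ℝ] ℝ where
  toFun p := ∫ x in (-1 : ℝ)..1, p.eval x
  map_add' p q := by
    simp only [eval_add]
    exact intervalIntegral.integral_add (p.continuous.intervalIntegrable _ _)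
      (q.continuous.intervalIntegrable _ _)
  map_smul' a p := by simp [eval_smul]

lemma polyIntegral_apply (p : ℝ[X]) : polyIntegral p = ∫ x in (-1 : ℝ)..1, p.eval x := rfl

lemma polyIntegral_C_mul (a : ℝ) (p : ℝ[X]) : polyIntegral (C a * p) = a * polyIntegral p := by
  rw [← smul_eq_C_mul, map_smul, smul_eq_mul]

/-- The pairing of the `k`-th derivatives of two Legendre polynomials, with weight
`(1 - x²)ᵏ`. -/
noncomputable def legendrePairing (k l l' : ℕ) : ℝ :=
  polyIntegral ((1 - X ^ 2) ^ k * derivative^[k] (legendrePoly l) *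
    derivative^[k] (legendrePoly l'))

lemma legendrePairing_comm (k l l' : ℕ) : legendrePairing k l l' = legendrePairing k l' l := by
  rw [legendrePairing, legendrePairing, mul_right_comm]

lemma legendrePairing_succ (k l l' : ℕ) :
    legendrePairing (k + 1) l l' =
      ((l : ℝ) - k) * (l + k + 1) * legendrePairing k l l' := by
  have h := integral_derivative_eval ((1 - X ^ 2) ^ (k + 1) * derivative^[k + 1] (legendrePoly l) *
    derivative^[k] (legendrePoly l'))
  have hd : derivative ((1 - X ^ 2) ^ (k + 1) * derivative^[k + 1] (legendrePoly l) *
      derivative^[k] (legendrePoly l')) =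
      (1 - X ^ 2) ^ (k + 1) * derivative^[k + 1] (legendrePoly l) *
        derivative^[k + 1] (legendrePoly l') -
      C (((l : ℝ) - k) * (l + k + 1)) * ((1 - X ^ 2) ^ k * derivative^[k] (legendrePoly l) *
        derivative^[k] (legendrePoly l')) := by
    have ode := legendrePoly_ode l k
    simp only [Function.iterate_succ_apply' _ (k + 1), Function.iterate_succ_apply' _ k] at ode ⊢
    simp only [derivative_mul, derivative_pow_succ, derivative_one,
      derivative_X, map_mul, map_add, map_sub, map_natCast, map_one]
    linear_combination (1 - X ^ 2) ^ k * derivative^[k] (legendrePoly l') * ode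
  rw [hd, ← polyIntegral_apply, map_sub, polyIntegral_C_mul] at h
  simp only [eval_mul, eval_pow, eval_sub, eval_one, eval_X, one_pow, even_two.neg_pow, sub_self,
    ne_eq, Nat.succ_ne_zero, not_false_eq_true, zero_pow, zero_mul] at h
  simp only [legendrePairing]
  linear_combination h

lemma legendrePairing_zero_of_ne {l l' : ℕ} (h : l ≠ l') : legendrePairing 0 l l' = 0 := by
  have h₁ := legendrePairing_succ 0 l l'
  have h₂ := legendrePairing_succ 0 l' l
  rw [legendrePairing_comm 1, legendrePairing_comm 0] at h₂
  have h₃ : ((l : ℝ) - l') * (l + l' + 1) * legendrePairing 0 l l' = 0 := by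
    push_cast at h₁ h₂
    linear_combination h₂ - h₁
  have h₄ : (l : ℝ) - l' ≠ 0 := sub_ne_zero.mpr (by exact_mod_cast h)
  have h₅ : (l : ℝ) + l' + 1 ≠ 0 := by positivity
  simpa [h₄, h₅] using h₃

lemma polyIntegral_X_mul_legendrePoly_succ_mul (l n : ℕ) :
    (2 * (l : ℝ) + 3) * polyIntegral (X * legendrePoly (l + 1) * legendrePoly n) =
      ((l : ℝ) + 2) * legendrePairing 0 (l + 2) n + ((l : ℝ) + 1) * legendrePairing 0 l n := by
  simp only [legendrePairing, ← polyIntegral_C_mul, ← map_add]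
  congr 1
  simp only [map_mul, map_add, map_natCast, map_one, map_ofNat, Function.iterate_zero, id, pow_zero]
  linear_combination legendrePoly n * X_mul_legendrePoly_succ l

lemma legendrePairing_zero_self (l : ℕ) : legendrePairing 0 l l = 2 / (2 * l + 1) := by
  induction l with
  | zero =>
    simp [legendrePairing, legendrePoly_zero, polyIntegral_apply]
    norm_num
  | succ l ih =>
    have h : (2 * (l : ℝ) + 3) * legendrePairing 0 (l + 1) (l + 1) =
        (2 * l + 1) * legendrePairing 0 l l := by
      have h₁ := polyIntegral_X_mul_legendrePoly_succ_mul l l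
      rw [legendrePairing_zero_of_ne (by omega : l + 2 ≠ l)] at h₁
      cases l with
      | zero =>
        have h₂ : polyIntegral (X * legendrePoly 1 * legendrePoly 0) = legendrePairing 0 1 1 := by
          simp [legendrePairing, legendrePoly_zero, legendrePoly_one]
        rw [zero_add, h₂] at h₁
        simpa using h₁
      | succ l =>
        have h₂ := polyIntegral_X_mul_legendrePoly_succ_mul l (l + 2)
        rw [legendrePairing_zero_of_ne (by omega : l ≠ l + 2), mul_right_comm] at h₂
        have h₃ : (l : ℝ) + 2 ≠ 0 := by positivity
        apply mul_left_cancel₀ h₃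
        push_cast at h₁ h₂ ⊢
        simp only [add_assoc, Nat.reduceAdd] at h₁ h₂ ⊢
        linear_combination (2 * (l : ℝ) + 3) * h₁ - (2 * (l : ℝ) + 5) * h₂
    rw [ih] at h
    have h₁ : 2 * (l : ℝ) + 1 ≠ 0 := by positivity
    have h₂ : 2 * (l : ℝ) + 3 ≠ 0 := by positivity
    rw [mul_div_cancel₀ _ h₁] at h
    push_cast
    rw [eq_div_iff (by positivity)]
    linear_combination h

lemma legendrePairing_of_ne (k : ℕ) {l l' : ℕ} (h : l ≠ l') : legendrePairing k l l' = 0 := by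
  induction k with
  | zero => exact legendrePairing_zero_of_ne h
  | succ k ih => rw [legendrePairing_succ, ih, mul_zero]

lemma legendrePairing_self {k l : ℕ} (h : k ≤ l) :
    legendrePairing k l l =
      2 / (2 * l + 1) * ((Nat.factorial (l + k) : ℝ) / (Nat.factorial (l - k) : ℝ)) := by
  induction k with
  | zero =>
    have : (Nat.factorial l : ℝ) ≠ 0 := by positivity
    simp [legendrePairing_zero_self, this]
  | succ k ih =>
    rw [legendrePairing_succ, ih (by omega)]
    obtain ⟨j, rfl⟩ := Nat.exists_eq_add_of_le h
    have e₁ : k + 1 + j - k = j + 1 := by omega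
    have e₂ : k + 1 + j - (k + 1) = j := by omega
    rw [e₁, e₂, ← add_assoc (k + 1 + j) k 1, Nat.factorial_succ (k + 1 + j + k),
      Nat.factorial_succ j]
    push_cast
    field_simp
    ring

end LegendreOrthogonality

section PolarPart

open Polynomial

/-- The normalisation constant of `Y_{lk}`. -/
noncomputable def harmonicNorm (l k : ℕ) : ℝ :=
  Real.sqrt ((2 * (l : ℝ) + 1) / (4 * Real.pi) *
    ((Nat.factorial (l - k) : ℝ) / (Nat.factorial (l + k) : ℝ)))

lemma sqrt_mul_eq_sqrt_mul_sqrt {a x y z : ℝ} (ha : 0 ≤ a) (hy : 0 ≤ y)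
    (h : x * a ^ 2 = y * z) : Real.sqrt x * a = Real.sqrt y * Real.sqrt z := by
  rw [← Real.sqrt_mul hy, ← h, Real.sqrt_mul' _ (sq_nonneg a), Real.sqrt_sq ha]

lemma harmonicNorm_succ_left {l k : ℕ} (h : k ≤ l) :
    harmonicNorm l k * (((l : ℝ) + 1 - k) / (2 * l + 1)) =
      Real.sqrt ((((l : ℝ) + 1) ^ 2 - (k : ℝ) ^ 2) / ((2 * (l : ℝ) + 1) * (2 * l + 3))) *
        harmonicNorm (l + 1) k := by
  obtain ⟨j, rfl⟩ := Nat.exists_eq_add_of_le h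
  have hpi := Real.pi_pos
  have e₁ : k + j - k = j := by omega
  have e₂ : k + j + 1 - k = j + 1 := by omega
  have e₃ : k + j + 1 + k = k + j + k + 1 := by omega
  rw [harmonicNorm, harmonicNorm, e₁, e₂, e₃, Nat.factorial_succ, Nat.factorial_succ]
  push_cast
  apply sqrt_mul_eq_sqrt_mul_sqrt
  · rw [show (k : ℝ) + j + 1 - k = j + 1 by ring]; positivity
  · rw [show ((k : ℝ) + j + 1) ^ 2 - (k : ℝ) ^ 2 = (j + 1) * (2 * k + j + 1) by ring]; positivity
  · field_simp
    ring

lemma harmonicNorm_pred_left {l k : ℕ} (h : k ≤ l) :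
    harmonicNorm (l + 1) k * (((l : ℝ) + 1 + k) / (2 * l + 3)) =
      Real.sqrt ((((l : ℝ) + 1) ^ 2 - (k : ℝ) ^ 2) / ((2 * (l : ℝ) + 1) * (2 * l + 3))) *
        harmonicNorm l k := by
  obtain ⟨j, rfl⟩ := Nat.exists_eq_add_of_le h
  have hpi := Real.pi_pos
  have e₁ : k + j - k = j := by omega
  have e₂ : k + j + 1 - k = j + 1 := by omega
  have e₃ : k + j + 1 + k = k + j + k + 1 := by omega
  rw [harmonicNorm, harmonicNorm, e₁, e₂, e₃, Nat.factorial_succ, Nat.factorial_succ]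
  push_cast
  apply sqrt_mul_eq_sqrt_mul_sqrt
  · positivity
  · rw [show ((k : ℝ) + j + 1) ^ 2 - (k : ℝ) ^ 2 = (j + 1) * (2 * k + j + 1) by ring]; positivity
  · field_simp
    ring

lemma harmonicNorm_succ_succ {l k : ℕ} (h : k ≤ l) :
    harmonicNorm l k * (1 / (2 * (l : ℝ) + 1)) =
      Real.sqrt ((((l : ℝ) + k + 1) * (l + k + 2)) / ((2 * (l : ℝ) + 1) * (2 * l + 3))) *
        harmonicNorm (l + 1) (k + 1) := by
  obtain ⟨j, rfl⟩ := Nat.exists_eq_add_of_le h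
  have hpi := Real.pi_pos
  have e₁ : k + j - k = j := by omega
  have e₂ : k + j + 1 - (k + 1) = j := by omega
  have e₃ : k + j + 1 + (k + 1) = k + j + k + 1 + 1 := by omega
  rw [harmonicNorm, harmonicNorm, e₁, e₂, e₃, Nat.factorial_succ, Nat.factorial_succ]
  push_cast
  apply sqrt_mul_eq_sqrt_mul_sqrt
  · positivity
  · positivity
  · field_simp
    ring

lemma harmonicNorm_pred_succ {l k : ℕ} (h : k + 1 ≤ l) :
    harmonicNorm (l + 1) k * (1 / (2 * (l : ℝ) + 3)) =
      Real.sqrt ((((l : ℝ) - k) * (l - k + 1)) / ((2 * (l : ℝ) + 1) * (2 * l + 3))) *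
        harmonicNorm l (k + 1) := by
  obtain ⟨j, rfl⟩ := Nat.exists_eq_add_of_le h
  have hpi := Real.pi_pos
  have e₁ : k + 1 + j + 1 - k = j + 1 + 1 := by omega
  have e₂ : k + 1 + j - (k + 1) = j := by omega
  have e₃ : k + 1 + j + 1 + k = k + 1 + j + (k + 1) := by omega
  rw [harmonicNorm, harmonicNorm, e₁, e₂, e₃, Nat.factorial_succ, Nat.factorial_succ]
  push_cast
  apply sqrt_mul_eq_sqrt_mul_sqrt
  · positivity
  · rw [show (k : ℝ) + 1 + j - k = j + 1 by ring]; positivity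
  · field_simp
    ring

lemma harmonicNorm_succ_pred {l k : ℕ} (h : k + 1 ≤ l) :
    harmonicNorm l (k + 1) * ((((l : ℝ) - k) * (l - k + 1)) / (2 * (l : ℝ) + 1)) =
      Real.sqrt ((((l : ℝ) - k) * (l - k + 1)) / ((2 * (l : ℝ) + 1) * (2 * l + 3))) *
        harmonicNorm (l + 1) k := by
  obtain ⟨j, rfl⟩ := Nat.exists_eq_add_of_le h
  have hpi := Real.pi_pos
  have e₁ : k + 1 + j + 1 - k = j + 1 + 1 := by omega
  have e₂ : k + 1 + j - (k + 1) = j := by omega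
  have e₃ : k + 1 + j + 1 + k = k + 1 + j + (k + 1) := by omega
  rw [harmonicNorm, harmonicNorm, e₁, e₂, e₃, Nat.factorial_succ, Nat.factorial_succ]
  push_cast
  apply sqrt_mul_eq_sqrt_mul_sqrt
  · rw [show (k : ℝ) + 1 + j - k = j + 1 by ring]; positivity
  · rw [show (k : ℝ) + 1 + j - k = j + 1 by ring]; positivity
  · field_simp
    ring

lemma harmonicNorm_pred_pred {l k : ℕ} (h : k ≤ l) :
    harmonicNorm (l + 1) (k + 1) * ((((l : ℝ) + k + 1) * (l + k + 2)) / (2 * (l : ℝ) + 3)) =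
      Real.sqrt ((((l : ℝ) + k + 1) * (l + k + 2)) / ((2 * (l : ℝ) + 1) * (2 * l + 3))) *
        harmonicNorm l k := by
  obtain ⟨j, rfl⟩ := Nat.exists_eq_add_of_le h
  have hpi := Real.pi_pos
  have e₁ : k + j - k = j := by omega
  have e₂ : k + j + 1 - (k + 1) = j := by omega
  have e₃ : k + j + 1 + (k + 1) = k + j + k + 1 + 1 := by omega
  rw [harmonicNorm, harmonicNorm, e₁, e₂, e₃, Nat.factorial_succ, Nat.factorial_succ]
  push_cast
  apply sqrt_mul_eq_sqrt_mul_sqrt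
  · positivity
  · positivity
  · field_simp
    ring

/-- The `θ`-dependent factor of `Y_{lk}` for `k ≥ 0`, as a trigonometric polynomial. -/
noncomputable def polarNat (l k : ℕ) (θ : ℝ) : ℝ :=
  harmonicNorm l k *
    ((-1) ^ k * Real.sin θ ^ k * (derivative^[k] (legendrePoly l)).eval (Real.cos θ))

lemma continuous_polarNat (l k : ℕ) : Continuous (polarNat l k) := by
  unfold polarNat
  fun_prop

lemma polarNat_eq_zero {l k : ℕ} (h : l < k) (θ : ℝ) : polarNat l k θ = 0 := by
  simp [polarNat, iterate_derivative_legendrePoly_eq_zero h]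

lemma integral_polarNat_mul_polarNat (l l' k : ℕ) (hk : k ≤ l) :
    ∫ θ in (0 : ℝ)..Real.pi, polarNat l k θ * polarNat l' k θ * Real.sin θ =
      if l = l' then 1 / (2 * Real.pi) else 0 := by
  have h : ∫ θ in (0 : ℝ)..Real.pi, polarNat l k θ * polarNat l' k θ * Real.sin θ =
      harmonicNorm l k * harmonicNorm l' k * legendrePairing k l l' := by
    have hs := intervalIntegral.integral_comp_mul_deriv (a := 0) (b := Real.pi)
      (fun x _ => Real.hasDerivAt_cos x) Real.continuous_sin.neg.continuousOn
      ((1 - X ^ 2) ^ k * derivative^[k] (legendrePoly l) *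
        derivative^[k] (legendrePoly l')).continuous
    rw [Real.cos_zero, Real.cos_pi, intervalIntegral.integral_symm (-1) 1, ← polyIntegral_apply,
      ← legendrePairing, ← neg_eq_iff_eq_neg, ← intervalIntegral.integral_neg] at hs
    rw [← hs, ← intervalIntegral.integral_const_mul]
    congr 1
    ext θ
    have h₁ : 1 - Real.cos θ ^ 2 = Real.sin θ ^ 2 := by rw [Real.sin_sq]
    have h₂ : ((-1 : ℝ) ^ k) ^ 2 = 1 := by rw [← pow_mul, mul_comm, pow_mul]; simp
    simp only [polarNat, Function.comp, eval_mul, eval_pow, eval_sub, eval_one, eval_X, h₁]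
    rw [← pow_mul, mul_comm 2 k, pow_mul]
    linear_combination (harmonicNorm l k * harmonicNorm l' k * (Real.sin θ ^ k) ^ 2 *
      eval (Real.cos θ) (derivative^[k] (legendrePoly l)) *
      eval (Real.cos θ) (derivative^[k] (legendrePoly l')) * Real.sin θ) * h₂
  rw [h]
  split_ifs with hl
  · subst hl
    have hpi := Real.pi_pos
    rw [legendrePairing_self hk, harmonicNorm, Real.mul_self_sqrt (by positivity)]
    field_simp
    norm_num
  · rw [legendrePairing_of_ne k hl, mul_zero]

lemma cos_mul_polarNat_succ {l k : ℕ} (h : k ≤ l + 1) (θ : ℝ) :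
    Real.cos θ * polarNat (l + 1) k θ =
      Real.sqrt ((((l : ℝ) + 2) ^ 2 - (k : ℝ) ^ 2) / ((2 * (l : ℝ) + 3) * (2 * l + 5))) *
        polarNat (l + 2) k θ +
      Real.sqrt ((((l : ℝ) + 1) ^ 2 - (k : ℝ) ^ 2) / ((2 * (l : ℝ) + 1) * (2 * l + 3))) *
        polarNat l k θ := by
  have e := congrArg (eval (Real.cos θ)) (X_mul_iterate_derivative_legendrePoly_succ l k)
  simp only [eval_mul, eval_add, eval_sub, eval_X, eval_natCast, eval_ofNat, eval_one] at e
  have n₁ := harmonicNorm_succ_left h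
  have n₂ : harmonicNorm (l + 1) k * (((l : ℝ) + 1 + k) / (2 * l + 3)) *
        (derivative^[k] (legendrePoly l)).eval (Real.cos θ) =
      Real.sqrt ((((l : ℝ) + 1) ^ 2 - (k : ℝ) ^ 2) / ((2 * (l : ℝ) + 1) * (2 * l + 3))) *
        harmonicNorm l k * (derivative^[k] (legendrePoly l)).eval (Real.cos θ) := by
    rcases Nat.lt_or_ge l k with hk | hk
    · simp [iterate_derivative_legendrePoly_eq_zero hk]
    · rw [harmonicNorm_pred_left hk]
  push_cast at n₁
  rw [show (l : ℝ) + 1 + 1 = l + 2 by ring, show 2 * ((l : ℝ) + 1) + 1 = 2 * l + 3 by ring,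
    show 2 * ((l : ℝ) + 1) + 3 = 2 * l + 5 by ring] at n₁
  simp only [polarNat]
  have h₃ : (2 * (l : ℝ) + 3) ≠ 0 := by positivity
  have e' : Real.cos θ * (derivative^[k] (legendrePoly (l + 1))).eval (Real.cos θ) =
      ((l : ℝ) + 2 - k) / (2 * l + 3) *
        (derivative^[k] (legendrePoly (l + 2))).eval (Real.cos θ) +
      ((l : ℝ) + 1 + k) / (2 * l + 3) * (derivative^[k] (legendrePoly l)).eval (Real.cos θ) := by
    field_simp
    linear_combination e
  linear_combination (-1) ^ k * Real.sin θ ^ k * (harmonicNorm (l + 1) k * e' +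
    (derivative^[k] (legendrePoly (l + 2))).eval (Real.cos θ) * n₁ + n₂)

lemma sin_mul_polarNat_succ {l k : ℕ} (h : k ≤ l + 1) (θ : ℝ) :
    Real.sin θ * polarNat (l + 1) k θ =
      -(Real.sqrt ((((l : ℝ) + k + 2) * (l + k + 3)) / ((2 * (l : ℝ) + 3) * (2 * l + 5))) *
        polarNat (l + 2) (k + 1) θ) +
      Real.sqrt ((((l : ℝ) - k) * (l - k + 1)) / ((2 * (l : ℝ) + 1) * (2 * l + 3))) *
        polarNat l (k + 1) θ := by
  have e := congrArg (eval (Real.cos θ)) (iterate_derivative_legendrePoly_succ l k)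
  simp only [eval_mul, eval_add, eval_sub, eval_natCast, eval_ofNat] at e
  have n₁ := harmonicNorm_succ_succ h
  have n₂ : harmonicNorm (l + 1) k * (1 / (2 * (l : ℝ) + 3)) *
        (derivative^[k + 1] (legendrePoly l)).eval (Real.cos θ) =
      Real.sqrt ((((l : ℝ) - k) * (l - k + 1)) / ((2 * (l : ℝ) + 1) * (2 * l + 3))) *
        harmonicNorm l (k + 1) * (derivative^[k + 1] (legendrePoly l)).eval (Real.cos θ) := by
    rcases Nat.lt_or_ge l (k + 1) with hk | hk
    · rw [iterate_derivative_legendrePoly_eq_zero hk]; simp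
    · rw [harmonicNorm_pred_succ hk]
  push_cast at n₁
  rw [show (l : ℝ) + 1 + k + 1 = l + k + 2 by ring, show (l : ℝ) + 1 + k + 2 = l + k + 3 by ring,
    show 2 * ((l : ℝ) + 1) + 1 = 2 * l + 3 by ring,
    show 2 * ((l : ℝ) + 1) + 3 = 2 * l + 5 by ring] at n₁
  simp only [polarNat]
  have h₃ : (2 * (l : ℝ) + 3) ≠ 0 := by positivity
  have e' : (derivative^[k] (legendrePoly (l + 1))).eval (Real.cos θ) =
      1 / (2 * (l : ℝ) + 3) * (derivative^[k + 1] (legendrePoly (l + 2))).eval (Real.cos θ) -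
      1 / (2 * (l : ℝ) + 3) * (derivative^[k + 1] (legendrePoly l)).eval (Real.cos θ) := by
    field_simp
    linear_combination e
  rw [e']
  linear_combination (-1) ^ k * Real.sin θ ^ (k + 1) *
    ((derivative^[k + 1] (legendrePoly (l + 2))).eval (Real.cos θ) * n₁ - n₂)

lemma sin_mul_polarNat_succ_succ {l k : ℕ} (h : k ≤ l) (θ : ℝ) :
    Real.sin θ * polarNat (l + 1) (k + 1) θ =
      Real.sqrt ((((l : ℝ) + 1 - k) * (l - k + 2)) / ((2 * (l : ℝ) + 3) * (2 * l + 5))) *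
        polarNat (l + 2) k θ -
      Real.sqrt ((((l : ℝ) + k + 1) * (l + k + 2)) / ((2 * (l : ℝ) + 1) * (2 * l + 3))) *
        polarNat l k θ := by
  have e := congrArg (eval (Real.cos θ)) (one_sub_X_sq_mul_iterate_derivative_legendrePoly l k)
  simp only [eval_mul, eval_add, eval_sub, eval_X, eval_natCast, eval_ofNat, eval_one,
    eval_pow] at e
  have n₁ := harmonicNorm_succ_pred (l := l + 1) (k := k) (by omega)
  have n₂ := harmonicNorm_pred_pred h
  push_cast at n₁
  rw [show (l : ℝ) + 1 - k + 1 = l - k + 2 by ring,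
    show 2 * ((l : ℝ) + 1) + 1 = 2 * l + 3 by ring,
    show 2 * ((l : ℝ) + 1) + 3 = 2 * l + 5 by ring] at n₁
  simp only [polarNat]
  have h₃ : (2 * (l : ℝ) + 3) ≠ 0 := by positivity
  have e' : Real.sin θ ^ 2 * (derivative^[k + 1] (legendrePoly (l + 1))).eval (Real.cos θ) =
      (((l : ℝ) + k + 1) * (l + k + 2)) / (2 * l + 3) *
        (derivative^[k] (legendrePoly l)).eval (Real.cos θ) -
      (((l : ℝ) + 1 - k) * (l - k + 2)) / (2 * l + 3) *
        (derivative^[k] (legendrePoly (l + 2))).eval (Real.cos θ) := by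
    rw [Real.sin_sq]
    field_simp
    linear_combination e
  linear_combination (-1) ^ k * Real.sin θ ^ k * (-harmonicNorm (l + 1) (k + 1) * e' +
    (derivative^[k] (legendrePoly (l + 2))).eval (Real.cos θ) * n₁ -
    (derivative^[k] (legendrePoly l)).eval (Real.cos θ) * n₂)

end PolarPart

section SphericalHarmonics

/-- The `θ`-dependent factor of `Y_{lm}`, as a trigonometric polynomial; it is zero outside the
range `|m| ≤ l`. -/
noncomputable def polar (l m : ℤ) (θ : ℝ) : ℝ :=
  if 0 ≤ l ∧ |m| ≤ l then
    (if 0 ≤ m then 1 else (-1 : ℝ) ^ m) * polarNat l.toNat m.natAbs θ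
  else 0

lemma continuous_polar (l m : ℤ) : Continuous (polar l m) := by
  unfold polar
  split_ifs
  · exact continuous_const.mul (continuous_polarNat _ _)
  · exact continuous_const.mul (continuous_polarNat _ _)
  · exact continuous_const

lemma polar_natCast (l k : ℕ) (θ : ℝ) : polar l k θ = polarNat l k θ := by
  unfold polar
  split_ifs with h h'
  · simp
  · exact absurd (Int.natCast_nonneg k) h'
  · rw [polarNat_eq_zero (by simp at h; omega)]

lemma polar_eq_zero {l m : ℤ} (h : ¬(0 ≤ l ∧ |m| ≤ l)) (θ : ℝ) : polar l m θ = 0 := if_neg h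

lemma neg_one_zpow_mul_self (m : ℤ) : (-1 : ℝ) ^ m * (-1 : ℝ) ^ m = 1 := by
  rw [← mul_zpow]
  simp

lemma neg_one_zpow_neg (m : ℤ) : (-1 : ℝ) ^ (-m) = (-1 : ℝ) ^ m := by
  rw [zpow_neg, ← inv_zpow]
  norm_num

lemma polar_neg (l m : ℤ) (θ : ℝ) : polar l (-m) θ = (-1 : ℝ) ^ m * polar l m θ := by
  unfold polar
  rw [abs_neg, Int.natAbs_neg]
  have h := neg_one_zpow_mul_self m
  rcases lt_trichotomy m 0 with hm | rfl | hm
  · rw [if_pos (by omega : 0 ≤ -m), if_neg (by omega : ¬ 0 ≤ m)]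
    split_ifs
    · linear_combination (-polarNat l.toNat m.natAbs θ) * h
    · simp
  · simp
  · rw [if_neg (by omega : ¬ 0 ≤ -m), if_pos (by omega : 0 ≤ m), neg_one_zpow_neg]
    split_ifs
    · ring
    · simp

lemma cos_mul_polar_natCast {l k : ℕ} (h : k ≤ l) (θ : ℝ) :
    Real.cos θ * polar l k θ =
      Real.sqrt ((((l : ℝ) + 1) ^ 2 - (k : ℝ) ^ 2) / ((2 * (l : ℝ) + 1) * (2 * l + 3))) *
        polar (l + 1) k θ +
      Real.sqrt (((l : ℝ) ^ 2 - (k : ℝ) ^ 2) / ((2 * (l : ℝ) - 1) * (2 * l + 1))) *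
        polar (l - 1) k θ := by
  cases l with
  | zero =>
    obtain rfl : k = 0 := by omega
    rw [polar_eq_zero (l := ((0 : ℕ) : ℤ) - 1) (by simp)]
    have e := harmonicNorm_succ_left (le_refl 0)
    have p := polar_natCast 0 0 θ
    have q := polar_natCast 1 0 θ
    simp [polarNat, legendrePoly_zero, legendrePoly_one] at e p q ⊢
    rw [p, q, e]
    ring
  | succ l =>
    have e := cos_mul_polarNat_succ h θ
    rw [← polar_natCast, ← polar_natCast, ← polar_natCast] at e
    push_cast at e ⊢
    rw [e]
    congr! 3 <;> ring_nf

lemma sin_mul_polar_natCast {l k : ℕ} (h : k ≤ l) (θ : ℝ) :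
    Real.sin θ * polar l k θ =
      -(Real.sqrt ((((l : ℝ) + k + 1) * (l + k + 2)) / ((2 * (l : ℝ) + 1) * (2 * l + 3))) *
        polar (l + 1) (k + 1) θ) +
      Real.sqrt ((((l : ℝ) - k - 1) * (l - k)) / ((2 * (l : ℝ) - 1) * (2 * l + 1))) *
        polar (l - 1) (k + 1) θ := by
  cases l with
  | zero =>
    obtain rfl : k = 0 := by omega
    rw [polar_eq_zero (l := ((0 : ℕ) : ℤ) - 1) (by simp)]
    have e := harmonicNorm_succ_succ (le_refl 0)
    have p := polar_natCast 0 0 θ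
    have q := polar_natCast 1 1 θ
    simp [polarNat, legendrePoly_zero, legendrePoly_one] at e p q ⊢
    rw [p, q, e]
    ring
  | succ l =>
    have e := sin_mul_polarNat_succ h θ
    rw [← polar_natCast, ← polar_natCast, ← polar_natCast] at e
    push_cast at e ⊢
    rw [e]
    congr! 4 <;> ring_nf

lemma sin_mul_polar_natCast_succ {l k : ℕ} (h : k + 1 ≤ l) (θ : ℝ) :
    Real.sin θ * polar l (k + 1) θ =
      Real.sqrt ((((l : ℝ) - k) * (l - k + 1)) / ((2 * (l : ℝ) + 1) * (2 * l + 3))) *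
        polar (l + 1) k θ -
      Real.sqrt ((((l : ℝ) + k) * (l + k + 1)) / ((2 * (l : ℝ) - 1) * (2 * l + 1))) *
        polar (l - 1) k θ := by
  obtain ⟨l, rfl⟩ : ∃ n, l = n + 1 := ⟨l - 1, by omega⟩
  have e := sin_mul_polarNat_succ_succ (by omega : k ≤ l) θ
  rw [← polar_natCast, ← polar_natCast, ← polar_natCast] at e
  push_cast at e ⊢
  rw [e]
  congr! 3 <;> ring_nf

lemma cos_mul_polar {l m : ℤ} (h : |m| ≤ l) (θ : ℝ) :
    Real.cos θ * polar l m θ =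
      Real.sqrt ((((l : ℝ) + 1) ^ 2 - (m : ℝ) ^ 2) / ((2 * (l : ℝ) + 1) * (2 * l + 3))) *
        polar (l + 1) m θ +
      Real.sqrt (((l : ℝ) ^ 2 - (m : ℝ) ^ 2) / ((2 * (l : ℝ) - 1) * (2 * l + 1))) *
        polar (l - 1) m θ := by
  lift l to ℕ using (abs_nonneg m).trans h
  obtain ⟨k, rfl | rfl⟩ := Int.eq_nat_or_neg m
  · have := cos_mul_polar_natCast (l := l) (k := k) (by simp at h; omega) θ
    exact_mod_cast this
  · have := cos_mul_polar_natCast (l := l) (k := k) (by simp at h; omega) θ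
    rw [polar_neg, polar_neg, polar_neg]
    push_cast at this ⊢
    rw [neg_sq]
    linear_combination (-1 : ℝ) ^ (k : ℤ) * this

lemma sin_mul_polar_and {l m : ℤ} (h : |m| ≤ l) (hm : 0 ≤ m) (θ : ℝ) :
    Real.sin θ * polar l m θ =
      -(Real.sqrt ((((l : ℝ) + m + 1) * (l + m + 2)) / ((2 * (l : ℝ) + 1) * (2 * l + 3))) *
        polar (l + 1) (m + 1) θ) +
      Real.sqrt ((((l : ℝ) - m - 1) * (l - m)) / ((2 * (l : ℝ) - 1) * (2 * l + 1))) *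
        polar (l - 1) (m + 1) θ ∧
    Real.sin θ * polar l m θ =
      Real.sqrt ((((l : ℝ) - m + 1) * (l - m + 2)) / ((2 * (l : ℝ) + 1) * (2 * l + 3))) *
        polar (l + 1) (m - 1) θ -
      Real.sqrt ((((l : ℝ) + m - 1) * (l + m)) / ((2 * (l : ℝ) - 1) * (2 * l + 1))) *
        polar (l - 1) (m - 1) θ := by
  lift l to ℕ using (abs_nonneg m).trans h
  lift m to ℕ using hm
  have hml : m ≤ l := by simp at h; omega
  have e₁ := sin_mul_polar_natCast hml θ
  refine ⟨by simpa only [Int.cast_natCast] using e₁, ?_⟩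
  cases m with
  | zero =>
    have p (l : ℤ) : polar l (-1) θ = -polar l 1 θ := by simpa using polar_neg l 1 θ
    simp only [Nat.cast_zero, Int.cast_zero, zero_add, add_zero, sub_zero, Int.cast_natCast,
      zero_sub, p] at e₁ ⊢
    rw [e₁]
    ring
  | succ k =>
    have e₂ := sin_mul_polar_natCast_succ hml θ
    push_cast
    rw [e₂, add_sub_cancel_right]
    congr! 3 <;> ring_nf

lemma sin_mul_polar_raise {l m : ℤ} (h : |m| ≤ l) (θ : ℝ) :
    Real.sin θ * polar l m θ =
      -(Real.sqrt ((((l : ℝ) + m + 1) * (l + m + 2)) / ((2 * (l : ℝ) + 1) * (2 * l + 3))) *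
        polar (l + 1) (m + 1) θ) +
      Real.sqrt ((((l : ℝ) - m - 1) * (l - m)) / ((2 * (l : ℝ) - 1) * (2 * l + 1))) *
        polar (l - 1) (m + 1) θ := by
  rcases le_total 0 m with hm | hm
  · exact (sin_mul_polar_and h hm θ).1
  · have e := (sin_mul_polar_and (l := l) (m := -m) (by rwa [abs_neg]) (by omega) θ).2
    rw [show -m - 1 = -(m + 1) by ring, polar_neg, polar_neg, polar_neg,
      zpow_add_one₀ (by norm_num)] at e
    push_cast at e
    simp only [sub_neg_eq_add, ← sub_eq_add_neg] at e
    have n : (-1 : ℝ) ^ m ≠ 0 := zpow_ne_zero _ (by norm_num)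
    apply mul_left_cancel₀ n
    linear_combination e

lemma sin_mul_polar_lower {l m : ℤ} (h : |m| ≤ l) (θ : ℝ) :
    Real.sin θ * polar l m θ =
      Real.sqrt ((((l : ℝ) - m + 1) * (l - m + 2)) / ((2 * (l : ℝ) + 1) * (2 * l + 3))) *
        polar (l + 1) (m - 1) θ -
      Real.sqrt ((((l : ℝ) + m - 1) * (l + m)) / ((2 * (l : ℝ) - 1) * (2 * l + 1))) *
        polar (l - 1) (m - 1) θ := by
  have e := sin_mul_polar_raise (l := l) (m := -m) (by rwa [abs_neg]) θ
  rw [show -m + 1 = -(m - 1) by ring, polar_neg, polar_neg, polar_neg,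
    zpow_sub_one₀ (by norm_num)] at e
  push_cast at e
  simp only [sub_neg_eq_add, ← sub_eq_add_neg, inv_neg, inv_one] at e
  have n : (-1 : ℝ) ^ m ≠ 0 := zpow_ne_zero _ (by norm_num)
  apply mul_left_cancel₀ n
  linear_combination e

lemma sphHarm_eq_polar_mul_exp (l m : ℤ) {θ : ℝ} (h : 0 ≤ Real.sin θ) (φ : ℝ) :
    sphHarm l m θ φ = (polar l m θ : ℂ) * Complex.exp (Complex.I * (m : ℂ) * (φ : ℂ)) := by
  unfold sphHarm polar
  split_ifs with hlm hm
  · congr 2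
    lift l to ℕ using hlm.1
    lift m to ℕ using hm
    have hml : m ≤ l := by have := hlm.2; simp at this; omega
    rw [assocLegendre, if_pos (Int.natCast_nonneg m)]
    simp only [Int.toNat_natCast, Int.natAbs_natCast, Int.cast_natCast,
      assocLegendreNat_cos l m h, polarNat, harmonicNorm, one_mul]
    rw [show ((l : ℤ) - m).toNat = l - m by omega, show ((l : ℤ) + m).toNat = l + m by omega]
  · congr 2
    lift l to ℕ using hlm.1
    obtain ⟨k, rfl⟩ : ∃ k : ℕ, m = -k := ⟨m.natAbs, by omega⟩
    have hml : k ≤ l := by have := hlm.2; simp at this; omega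
    rw [assocLegendre, if_neg hm]
    simp only [Int.toNat_natCast, Int.natAbs_natCast, Int.cast_natCast, Int.natAbs_neg,
      assocLegendreNat_cos l k h, polarNat, neg_one_zpow_neg, zpow_natCast]
    rw [show ((l : ℤ) - -k).toNat = l + k by omega, show ((l : ℤ) + -k).toNat = l - k by omega]
    have n : Real.sqrt ((2 * (l : ℝ) + 1) / (4 * Real.pi) *
          ((Nat.factorial (l + k) : ℝ) / (Nat.factorial (l - k) : ℝ))) *
        ((Nat.factorial (l - k) : ℝ) / (Nat.factorial (l + k) : ℝ)) = harmonicNorm l k := by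
      have hpi := Real.pi_pos
      have := sqrt_mul_eq_sqrt_mul_sqrt (a := (Nat.factorial (l - k) : ℝ) / Nat.factorial (l + k))
        (x := (2 * (l : ℝ) + 1) / (4 * Real.pi) *
          ((Nat.factorial (l + k) : ℝ) / (Nat.factorial (l - k) : ℝ))) (y := 1)
        (z := (2 * (l : ℝ) + 1) / (4 * Real.pi) *
          ((Nat.factorial (l - k) : ℝ) / (Nat.factorial (l + k) : ℝ)))
        (by positivity) zero_le_one (by field_simp)
      rw [this, Real.sqrt_one, one_mul, harmonicNorm]
    linear_combination (-1 : ℝ) ^ k * ((-1) ^ k * Real.sin θ ^ k *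
      (Polynomial.derivative^[k] (legendrePoly l)).eval (Real.cos θ)) * n
  · simp

lemma integral_polar_mul_polar (l l' m : ℤ) (h : |m| ≤ l) :
    ∫ θ in (0 : ℝ)..Real.pi, polar l m θ * polar l' m θ * Real.sin θ =
      if l = l' then 1 / (2 * Real.pi) else 0 := by
  by_cases h' : 0 ≤ l'
  · have e (θ : ℝ) : polar l m θ * polar l' m θ =
        polarNat l.toNat m.natAbs θ * polarNat l'.toNat m.natAbs θ := by
      lift l to ℕ using (abs_nonneg m).trans h
      lift l' to ℕ using h'
      obtain ⟨k, rfl | rfl⟩ := Int.eq_nat_or_neg m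
      · simp [polar_natCast]
      · rw [polar_neg, polar_neg, polar_natCast, polar_natCast]
        simp only [Int.toNat_natCast, Int.natAbs_neg, Int.natAbs_natCast]
        linear_combination polarNat l k θ * polarNat l' k θ * neg_one_zpow_mul_self (k : ℤ)
    simp only [e]
    have hm := Int.abs_eq_natAbs m
    rw [integral_polarNat_mul_polarNat _ _ _ (by omega)]
    congr 1
    have := abs_nonneg m
    simp only [eq_iff_iff]
    omega
  · have := abs_nonneg m
    simp [polar_eq_zero (l := l') (m := m) (by omega), show l ≠ l' by omega]

lemma integral_exp_I_mul (n : ℤ) :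
    ∫ φ in (0 : ℝ)..(2 * Real.pi), Complex.exp (Complex.I * (n : ℂ) * (φ : ℂ)) =
      if n = 0 then 2 * Real.pi else 0 := by
  split_ifs with h
  · simp [h]
  · have hn : Complex.I * (n : ℂ) ≠ 0 := mul_ne_zero Complex.I_ne_zero (by exact_mod_cast h)
    rw [integral_exp_mul_complex hn]
    have : Complex.exp (Complex.I * (n : ℂ) * ((2 * Real.pi : ℝ) : ℂ)) = 1 :=
      Complex.exp_eq_one_iff.mpr ⟨n, by push_cast; ring⟩
    rw [this]
    simp

end SphericalHarmonics

section SphereIntegral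

lemma sphereIntegral_congr {f g : ℝ → ℝ → ℂ}
    (h : ∀ θ φ, 0 ≤ Real.sin θ → f θ φ = g θ φ) : sphereIntegral f = sphereIntegral g := by
  unfold sphereIntegral
  congr 1
  ext φ
  refine intervalIntegral.integral_congr fun θ hθ => ?_
  rw [Set.uIcc_of_le Real.pi_pos.le] at hθ
  simp only [h θ φ (Real.sin_nonneg_of_mem_Icc hθ)]

lemma sphereIntegral_sum {ι : Type*} (s : Finset ι) (c : ι → ℂ) (f : ι → ℝ → ℝ → ℂ)
    (hf : ∀ i, Continuous (Function.uncurry (f i))) :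
    sphereIntegral (fun θ φ => ∑ i ∈ s, c i * f i θ φ) = ∑ i ∈ s, c i * sphereIntegral (f i) := by
  have hg (i : ι) : Continuous (Function.uncurry fun φ θ => f i θ φ * ((Real.sin θ : ℝ) : ℂ)) := by
    have := hf i
    simp only [Function.uncurry_def] at this ⊢
    exact (this.comp continuous_swap).mul (by fun_prop)
  have h₁ (φ : ℝ) : ∫ θ in (0 : ℝ)..Real.pi,
        (∑ i ∈ s, c i * f i θ φ) * ((Real.sin θ : ℝ) : ℂ) =
      ∑ i ∈ s, c i * ∫ θ in (0 : ℝ)..Real.pi, f i θ φ * ((Real.sin θ : ℝ) : ℂ) := by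
    simp only [Finset.sum_mul, mul_assoc]
    rw [intervalIntegral.integral_finsetSum]
    · simp only [intervalIntegral.integral_const_mul]
    · intro i _
      exact (continuous_const.mul
        ((hg i).comp (Continuous.prodMk_right φ))).intervalIntegrable _ _
  unfold sphereIntegral
  simp only [h₁]
  rw [intervalIntegral.integral_finsetSum]
  · simp only [intervalIntegral.integral_const_mul]
  · intro i _
    exact (continuous_const.mul (intervalIntegral.continuous_parametric_intervalIntegral_of_continuous'
      (hg i) _ _)).intervalIntegrable _ _

/-- The spherical harmonic `Y_{lm}` as a trigonometric polynomial in both angles. -/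
noncomputable def trigHarm (l m : ℤ) (θ φ : ℝ) : ℂ :=
  (polar l m θ : ℂ) * Complex.exp (Complex.I * (m : ℂ) * (φ : ℂ))

lemma conj_trigHarm (l m : ℤ) (θ φ : ℝ) :
    (starRingEnd ℂ) (trigHarm l m θ φ) =
      (polar l m θ : ℂ) * Complex.exp (Complex.I * ((-m : ℤ) : ℂ) * (φ : ℂ)) := by
  rw [trigHarm, map_mul, Complex.conj_ofReal, ← Complex.exp_conj]
  simp

lemma continuous_trigHarm (l m : ℤ) : Continuous (Function.uncurry (trigHarm l m)) := by
  have := continuous_polar l m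
  unfold trigHarm Function.uncurry
  fun_prop

lemma continuous_trigHarm_mul_conj_trigHarm (l m l' m' : ℤ) :
    Continuous (Function.uncurry fun θ φ =>
      trigHarm l m θ φ * (starRingEnd ℂ) (trigHarm l' m' θ φ)) :=
  (continuous_trigHarm l m).mul (Complex.continuous_conj.comp (continuous_trigHarm l' m'))

lemma sphereIntegral_trigHarm_mul_conj_trigHarm {l m : ℤ} (h : |m| ≤ l) (l' m' : ℤ) :
    sphereIntegral (fun θ φ => trigHarm l m θ φ * (starRingEnd ℂ) (trigHarm l' m' θ φ)) =
      if l = l' ∧ m = m' then 1 else 0 := by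
  have e (φ θ : ℝ) : trigHarm l m θ φ * (starRingEnd ℂ) (trigHarm l' m' θ φ) *
        ((Real.sin θ : ℝ) : ℂ) =
      Complex.exp (Complex.I * ((m - m' : ℤ) : ℂ) * (φ : ℂ)) *
        ((polar l m θ * polar l' m' θ * Real.sin θ : ℝ) : ℂ) := by
    rw [conj_trigHarm, trigHarm, show Complex.I * ((m - m' : ℤ) : ℂ) * (φ : ℂ) =
      Complex.I * (m : ℂ) * (φ : ℂ) + Complex.I * ((-m' : ℤ) : ℂ) * (φ : ℂ) by push_cast; ring,
      Complex.exp_add]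
    push_cast
    ring
  unfold sphereIntegral
  simp only [e, intervalIntegral.integral_const_mul, intervalIntegral.integral_mul_const,
    integral_exp_I_mul, intervalIntegral.integral_ofReal]
  rcases eq_or_ne m m' with rfl | hm
  · rw [integral_polar_mul_polar _ _ _ h]
    have hpi : (Real.pi : ℂ) ≠ 0 := by exact_mod_cast Real.pi_ne_zero
    split_ifs with h₁ h₂ h₃ h₃
    · push_cast
      field_simp
    all_goals simp_all
  · simp [sub_ne_zero.mpr hm, hm]

lemma sphereIntegral_sum_trigHarm_mul_sum_conj_trigHarm {ι : Type*} [Fintype ι]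
    (L : ℤ) (a : ℤ → ℤ → ℂ) (ha : ∀ l m : ℤ, (l < 2 ∨ L < l ∨ l < |m|) → a l m = 0)
    (c : ι → ℂ) (l m : ι → ℤ) :
    sphereIntegral (fun θ φ =>
      (∑ l ∈ Finset.Icc (2 : ℤ) L, ∑ m ∈ Finset.Icc (-l) l, a l m * trigHarm l m θ φ) *
        ∑ i, c i * (starRingEnd ℂ) (trigHarm (l i) (m i) θ φ)) = ∑ i, c i * a (l i) (m i) := by
  have h₁ (θ φ : ℝ) :
      (∑ l ∈ Finset.Icc (2 : ℤ) L, ∑ m ∈ Finset.Icc (-l) l, a l m * trigHarm l m θ φ) *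
        ∑ i, c i * (starRingEnd ℂ) (trigHarm (l i) (m i) θ φ) =
      ∑ x ∈ (Finset.univ : Finset ι) ×ˢ (Finset.Icc (2 : ℤ) L).sigma fun l => Finset.Icc (-l) l,
        (c x.1 * a x.2.1 x.2.2) * (trigHarm x.2.1 x.2.2 θ φ *
          (starRingEnd ℂ) (trigHarm (l x.1) (m x.1) θ φ)) := by
    rw [Finset.sum_product, mul_comm, Finset.sum_mul]
    refine Finset.sum_congr rfl fun i _ => ?_
    rw [Finset.sum_sigma', Finset.mul_sum]
    exact Finset.sum_congr rfl fun x _ => by ring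
  simp only [h₁]
  rw [sphereIntegral_sum _ (fun x : ι × (Σ _ : ℤ, ℤ) => c x.1 * a x.2.1 x.2.2)
    (fun x θ φ => trigHarm x.2.1 x.2.2 θ φ * (starRingEnd ℂ) (trigHarm (l x.1) (m x.1) θ φ))
    fun x => continuous_trigHarm_mul_conj_trigHarm _ _ _ _, Finset.sum_product]
  refine Finset.sum_congr rfl fun i _ => ?_
  rw [Finset.sum_eq_single ⟨l i, m i⟩]
  · by_cases h : |m i| ≤ l i
    · rw [sphereIntegral_trigHarm_mul_conj_trigHarm h, if_pos ⟨rfl, rfl⟩, mul_one]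
    · rw [ha _ _ (Or.inr (Or.inr (not_le.mp h)))]
      simp
  · rintro ⟨l', m'⟩ hx hne
    simp only [Finset.mem_sigma, Finset.mem_Icc, ← abs_le] at hx
    rw [sphereIntegral_trigHarm_mul_conj_trigHarm hx.2, if_neg, mul_zero]
    rintro ⟨hl, hm⟩
    dsimp only at hl hm
    subst hl hm
    exact hne rfl
  · intro hx
    simp only [Finset.mem_sigma, Finset.mem_Icc, ← abs_le] at hx
    have h₀ : a (l i) (m i) = 0 := ha _ _ (by omega)
    simp [h₀]

lemma dipole_mul_conj_trigHarm {l m : ℤ} (h : |m| ≤ l) (A Θ Φ θ φ : ℝ) :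
    ((1 + A * (Real.cos Θ * Real.cos θ + Real.sin Θ * Real.sin θ * Real.cos (φ - Φ)) : ℝ) : ℂ) *
        (starRingEnd ℂ) (trigHarm l m θ φ) =
      (starRingEnd ℂ) (trigHarm l m θ φ) +
      ((A * Real.cos Θ : ℝ) : ℂ) *
        (((Real.sqrt ((((l : ℝ) + 1) ^ 2 - (m : ℝ) ^ 2) /
            ((2 * (l : ℝ) + 1) * (2 * (l : ℝ) + 3))) : ℝ) : ℂ) *
            (starRingEnd ℂ) (trigHarm (l + 1) m θ φ) +
          ((Real.sqrt (((l : ℝ) ^ 2 - (m : ℝ) ^ 2) /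
            ((2 * (l : ℝ) - 1) * (2 * (l : ℝ) + 1))) : ℝ) : ℂ) *
            (starRingEnd ℂ) (trigHarm (l - 1) m θ φ)) +
      ((A * Real.sin Θ / 2 : ℝ) : ℂ) * Complex.exp (-(Complex.I * (Φ : ℂ))) *
        (((Real.sqrt ((((l : ℝ) - (m : ℝ) + 1) * ((l : ℝ) - (m : ℝ) + 2)) /
            ((2 * (l : ℝ) + 1) * (2 * (l : ℝ) + 3))) : ℝ) : ℂ) *
            (starRingEnd ℂ) (trigHarm (l + 1) (m - 1) θ φ) -
          ((Real.sqrt ((((l : ℝ) + (m : ℝ) - 1) * ((l : ℝ) + (m : ℝ))) /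
            ((2 * (l : ℝ) - 1) * (2 * (l : ℝ) + 1))) : ℝ) : ℂ) *
            (starRingEnd ℂ) (trigHarm (l - 1) (m - 1) θ φ)) +
      ((A * Real.sin Θ / 2 : ℝ) : ℂ) * Complex.exp (Complex.I * (Φ : ℂ)) *
        (((Real.sqrt ((((l : ℝ) - (m : ℝ) - 1) * ((l : ℝ) - (m : ℝ))) /
            ((2 * (l : ℝ) - 1) * (2 * (l : ℝ) + 1))) : ℝ) : ℂ) *
            (starRingEnd ℂ) (trigHarm (l - 1) (m + 1) θ φ) -
          ((Real.sqrt ((((l : ℝ) + (m : ℝ) + 1) * ((l : ℝ) + (m : ℝ) + 2)) /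
            ((2 * (l : ℝ) + 1) * (2 * (l : ℝ) + 3))) : ℝ) : ℂ) *
            (starRingEnd ℂ) (trigHarm (l + 1) (m + 1) θ φ)) := by
  have e₀ := congrArg Complex.ofReal (cos_mul_polar h θ)
  have e₁ := congrArg Complex.ofReal (sin_mul_polar_raise h θ)
  have e₂ := congrArg Complex.ofReal (sin_mul_polar_lower h θ)
  simp only [Complex.ofReal_add, Complex.ofReal_sub, Complex.ofReal_neg,
    Complex.ofReal_mul] at e₀ e₁ e₂
  have x₁ : Complex.exp (Complex.I * ((-(m - 1) : ℤ) : ℂ) * (φ : ℂ)) =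
      Complex.exp (Complex.I * ((-m : ℤ) : ℂ) * (φ : ℂ)) * Complex.exp (Complex.I * φ) := by
    rw [← Complex.exp_add]
    push_cast
    ring_nf
  have x₂ : Complex.exp (Complex.I * ((-(m + 1) : ℤ) : ℂ) * (φ : ℂ)) =
      Complex.exp (Complex.I * ((-m : ℤ) : ℂ) * (φ : ℂ)) * Complex.exp (-(Complex.I * φ)) := by
    rw [← Complex.exp_add]
    push_cast
    ring_nf
  have x₃ : ((Real.cos (φ - Φ) : ℝ) : ℂ) =
      (Complex.exp (Complex.I * φ) * Complex.exp (-(Complex.I * (Φ : ℂ))) +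
        Complex.exp (-(Complex.I * φ)) * Complex.exp (Complex.I * (Φ : ℂ))) / 2 := by
    rw [Complex.ofReal_cos, Complex.cos, ← Complex.exp_add, ← Complex.exp_add]
    push_cast
    ring_nf
  simp only [conj_trigHarm, x₁, x₂]
  simp only [Complex.ofReal_add, Complex.ofReal_mul, Complex.ofReal_div, Complex.ofReal_one,
    Complex.ofReal_ofNat, x₃]
  linear_combination Complex.exp (Complex.I * ((-m : ℤ) : ℂ) * (φ : ℂ)) * (A : ℂ) *
    ((Real.cos Θ : ℂ) * e₀ +
      (Real.sin Θ : ℂ) / 2 * Complex.exp (Complex.I * φ) *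
        Complex.exp (-(Complex.I * (Φ : ℂ))) * e₂ +
      (Real.sin Θ : ℂ) / 2 * Complex.exp (-(Complex.I * φ)) *
        Complex.exp (Complex.I * (Φ : ℂ)) * e₁)

lemma sphereIntegral_sum_trigHarm_mul_mul_conj_trigHarm
    (L : ℤ) (a : ℤ → ℤ → ℂ) (ha : ∀ l m : ℤ, (l < 2 ∨ L < l ∨ l < |m|) → a l m = 0)
    {u v w c₁ c₂ c₃ c₄ c₅ c₆ : ℂ} {l m : ℤ} {F : ℝ → ℝ → ℂ}
    (hF : ∀ θ φ, F θ φ * (starRingEnd ℂ) (trigHarm l m θ φ) =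
      (starRingEnd ℂ) (trigHarm l m θ φ) +
      u * (c₁ * (starRingEnd ℂ) (trigHarm (l + 1) m θ φ) +
        c₂ * (starRingEnd ℂ) (trigHarm (l - 1) m θ φ)) +
      v * (c₃ * (starRingEnd ℂ) (trigHarm (l + 1) (m - 1) θ φ) -
        c₄ * (starRingEnd ℂ) (trigHarm (l - 1) (m - 1) θ φ)) +
      w * (c₅ * (starRingEnd ℂ) (trigHarm (l - 1) (m + 1) θ φ) -
        c₆ * (starRingEnd ℂ) (trigHarm (l + 1) (m + 1) θ φ))) :
    sphereIntegral (fun θ φ =>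
      (∑ l ∈ Finset.Icc (2 : ℤ) L, ∑ m ∈ Finset.Icc (-l) l, a l m * trigHarm l m θ φ) *
        F θ φ * (starRingEnd ℂ) (trigHarm l m θ φ)) =
      a l m + u * (c₁ * a (l + 1) m + c₂ * a (l - 1) m) +
      v * (c₃ * a (l + 1) (m - 1) - c₄ * a (l - 1) (m - 1)) +
      w * (c₅ * a (l - 1) (m + 1) - c₆ * a (l + 1) (m + 1)) := by
  have h := sphereIntegral_sum_trigHarm_mul_sum_conj_trigHarm L a ha
    ![1, u * c₁, u * c₂, v * c₃, -(v * c₄), w * c₅, -(w * c₆)]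
    ![l, l + 1, l - 1, l + 1, l - 1, l - 1, l + 1]
    ![m, m, m, m - 1, m - 1, m + 1, m + 1]
  simp only [Fin.sum_univ_seven] at h
  convert h using 1
  · congr 1
    ext θ φ
    rw [mul_assoc, hF]
    congr 1
    simp
    ring
  · simp
    ring

end SphereIntegral

/-- **Dipole modulation correlates multipoles `l` and `l ± 1` only.**
With the convention `E_{lm} = 0` for `l < 2`, `l > L` or `|m| > l`, the coefficients of
`Ē = E (1 + A (cos Θ cos θ + sin Θ sin θ cos (φ - Φ)))` are
`Ē_{lm} = E_{lm} + A cos Θ [⋯ E_{l+1,m} + ⋯ E_{l-1,m}]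
 + (A sin Θ / 2) e^{-iΦ} [⋯ E_{l+1,m-1} - ⋯ E_{l-1,m-1}]
 + (A sin Θ / 2) e^{iΦ} [⋯ E_{l-1,m+1} - ⋯ E_{l+1,m+1}]`. -/
theorem dipole_modulated_coefficients
    (L : ℤ) (hL : 2 ≤ L) (Ec : ℤ → ℤ → ℂ)
    (hEc : ∀ l m : ℤ, (l < 2 ∨ L < l ∨ (l : ℤ) < |m|) → Ec l m = 0)
    (A Θ Φ : ℝ)
    (hΘ : Θ ∈ Set.Icc (0 : ℝ) Real.pi) (hΦ : Φ ∈ Set.Ico (0 : ℝ) (2 * Real.pi))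
    (E Ebar : ℝ → ℝ → ℂ)
    (hE : E = fun θ φ => ∑ l ∈ Finset.Icc (2 : ℤ) L, ∑ m ∈ Finset.Icc (-l) l,
      Ec l m * sphHarm l m θ φ)
    (hEbar : Ebar = fun θ φ => E θ φ *
      (((1 + A * (Real.cos Θ * Real.cos θ + Real.sin Θ * Real.sin θ * Real.cos (φ - Φ)) : ℝ)) : ℂ)) :
    ∀ l m : ℤ, 0 ≤ l → |m| ≤ l →
      sphereIntegral (fun θ φ => Ebar θ φ * (starRingEnd ℂ) (sphHarm l m θ φ)) =
        Ec l m +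
        ((A * Real.cos Θ : ℝ) : ℂ) *
          (((Real.sqrt ((((l : ℝ) + 1) ^ 2 - (m : ℝ) ^ 2) /
              ((2 * (l : ℝ) + 1) * (2 * (l : ℝ) + 3))) : ℝ) : ℂ) * Ec (l + 1) m +
            ((Real.sqrt (((l : ℝ) ^ 2 - (m : ℝ) ^ 2) /
              ((2 * (l : ℝ) - 1) * (2 * (l : ℝ) + 1))) : ℝ) : ℂ) * Ec (l - 1) m) +
        ((A * Real.sin Θ / 2 : ℝ) : ℂ) * Complex.exp (-(Complex.I * (Φ : ℂ))) *
          (((Real.sqrt ((((l : ℝ) - (m : ℝ) + 1) * ((l : ℝ) - (m : ℝ) + 2)) /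
              ((2 * (l : ℝ) + 1) * (2 * (l : ℝ) + 3))) : ℝ) : ℂ) * Ec (l + 1) (m - 1) -
            ((Real.sqrt ((((l : ℝ) + (m : ℝ) - 1) * ((l : ℝ) + (m : ℝ))) /
              ((2 * (l : ℝ) - 1) * (2 * (l : ℝ) + 1))) : ℝ) : ℂ) * Ec (l - 1) (m - 1)) +
        ((A * Real.sin Θ / 2 : ℝ) : ℂ) * Complex.exp (Complex.I * (Φ : ℂ)) *
          (((Real.sqrt ((((l : ℝ) - (m : ℝ) - 1) * ((l : ℝ) - (m : ℝ))) /
              ((2 * (l : ℝ) - 1) * (2 * (l : ℝ) + 1))) : ℝ) : ℂ) * Ec (l - 1) (m + 1) -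
            ((Real.sqrt ((((l : ℝ) + (m : ℝ) + 1) * ((l : ℝ) + (m : ℝ) + 2)) /
              ((2 * (l : ℝ) + 1) * (2 * (l : ℝ) + 3))) : ℝ) : ℂ) * Ec (l + 1) (m + 1)) := by
  intro l m _ hm
  subst hE hEbar
  rw [← sphereIntegral_sum_trigHarm_mul_mul_conj_trigHarm L Ec hEc
    (dipole_mul_conj_trigHarm hm A Θ Φ)]
  refine sphereIntegral_congr fun θ φ h => ?_
  simp only [sphHarm_eq_polar_mul_exp _ _ h, trigHarm]
end

section
/- Let L ≥ 2 and suppose the complex functions Q ± iU on the sphere are band-limited spin ±2 fields: Q + iU = Σ_{l=2}^{L} Σ_{m=−l}^{l} a_{2,lm} Y_{2,lm} and Q − iU = Σ_{l=2}^{L} Σ_{m=−l}^{l} a_{−2,lm} Y_{−2,lm}, with complex coefficients a_{±2,lm}. Define the E-mode field E = −(1/2)[ð²(Q − iU) + ð̄²(Q + iU)], where ð² denotes applying ð first at spin weight −2 and then at spin weight −1, and ð̄² denotes applying ð̄ first at spin weight 2 and then at spin weight 1. Then for l = 0 and l = 1 and every −l ≤ m ≤ l, the spherical harmonic coefficient E_{lm}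 := ∫ E · conj(Y_{lm}) dΩ equals 0. -/
open scoped Real
open Complex

/-- Span of the products `sin^(i+j) (θ/2) cos^(p+q) (θ/2)` which occur in the polar dependence of
spin-weight-`s` harmonics of azimuthal order `m`. -/
def spinSpan (s m : ℤ) : Submodule ℂ (ℝ → ℂ) :=
  Submodule.span ℂ {f | ∃ i p j q : ℕ, (j : ℤ) = i + s + m ∧ (q : ℤ) = p + s - m ∧
    f = fun θ : ℝ => ((Real.sin (θ / 2) : ℝ) : ℂ) ^ (i + j) * ((Real.cos (θ / 2) : ℝ) : ℂ) ^ (p + q)}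

lemma spinSpan_neg_le (s m : ℤ) : spinSpan s m ≤ spinSpan (-s) (-m) := by
  refine Submodule.span_mono ?_
  rintro f ⟨i, p, j, q, h1, h2, rfl⟩
  refine ⟨j, q, i, p, by omega, by omega, ?_⟩
  rw [add_comm j i, add_comm q p]

lemma halfAngle_mem_spinSpan {s m : ℤ} {i p j q : ℕ} (h1 : (j : ℤ) = i + s + m)
    (h2 : (q : ℤ) = p + s - m) :
    (fun θ : ℝ => ((Real.sin (θ / 2) : ℝ) : ℂ) ^ (i + j) * ((Real.cos (θ / 2) : ℝ) : ℂ) ^ (p + q))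
      ∈ spinSpan s m :=
  Submodule.subset_span ⟨i, p, j, q, h1, h2, rfl⟩

lemma hasDerivAt_ofReal_sin_half (θ : ℝ) :
    HasDerivAt (fun θ : ℝ => ((Real.sin (θ / 2) : ℝ) : ℂ)) ((Real.cos (θ / 2) : ℝ) / 2) θ := by
  have := ((Real.hasDerivAt_sin (θ / 2)).comp θ ((hasDerivAt_id θ).div_const 2)).ofReal_comp
  exact this.congr_deriv (by push_cast; ring)

lemma hasDerivAt_ofReal_cos_half (θ : ℝ) :
    HasDerivAt (fun θ : ℝ => ((Real.cos (θ / 2) : ℝ) : ℂ)) (-(Real.sin (θ / 2) : ℝ) / 2) θ := by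
  have := ((Real.hasDerivAt_cos (θ / 2)).comp θ ((hasDerivAt_id θ).div_const 2)).ofReal_comp
  exact this.congr_deriv (by push_cast; ring)

lemma hasDerivAt_ofReal_sin (θ : ℝ) :
    HasDerivAt (fun θ : ℝ => ((Real.sin θ : ℝ) : ℂ)) (Real.cos θ : ℝ) θ :=
  (Real.hasDerivAt_sin θ).ofReal_comp

lemma hasDerivAt_ofReal_cos (θ : ℝ) :
    HasDerivAt (fun θ : ℝ => ((Real.cos θ : ℝ) : ℂ)) (-(Real.sin θ : ℝ)) θ := by
  simpa using (Real.hasDerivAt_cos θ).ofReal_comp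

/-- The polar part of `ð` on the monomials spanning `spinSpan`. -/
lemma halfAngle_raise {c σ S C s m : ℂ} {i p j q : ℕ} (hσ : σ ≠ 0) (hc : c ≠ 0)
    (hS : S = 2 * σ * c) (hC : C = c ^ 2 - σ ^ 2) (hone : σ ^ 2 + c ^ 2 = 1)
    (h1 : (j : ℂ) = i + s + m) (h2 : (q : ℂ) = p + s - m) :
    -(((i + j : ℕ) : ℂ) * σ ^ (i + j - 1) * (c / 2) * c ^ (p + q) +
        σ ^ (i + j) * (((p + q : ℕ) : ℂ) * c ^ (p + q - 1) * (-σ / 2)) -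
        s * (C / S) * (σ ^ (i + j) * c ^ (p + q)) - m / S * (σ ^ (i + j) * c ^ (p + q))) =
      -(i : ℂ) * (σ ^ (i - 1 + j) * c ^ (p + (q + 1))) +
        p * (σ ^ (i + (j + 1)) * c ^ (p - 1 + q)) := by
  have e1 : ∀ (n : ℕ) (x : ℂ), x ≠ 0 → (n : ℂ) * x ^ (n - 1) = n * x ^ n / x := by
    intro n x hx
    rcases n with _ | n
    · simp
    · simp [pow_succ]
      field_simp
  have e2 : ∀ (n k : ℕ) (x : ℂ), x ≠ 0 → (n : ℂ) * x ^ (n - 1 + k) = n * x ^ (n + k) / x := by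
    intro n k x hx
    rw [pow_add, ← mul_assoc, e1 n x hx, pow_add]
    ring
  have l1 : -(i : ℂ) * (σ ^ (i - 1 + j) * c ^ (p + (q + 1))) =
      -(i * σ ^ (i + j) / σ) * (c ^ (p + q) * c) := by
    rw [← e2 i j σ hσ, ← add_assoc, pow_succ]
    ring
  have l2 : (p : ℂ) * (σ ^ (i + (j + 1)) * c ^ (p - 1 + q)) =
      (p * c ^ (p + q) / c) * (σ ^ (i + j) * σ) := by
    rw [← e2 p q c hc, ← add_assoc, pow_succ]
    ring
  rw [l1, l2, e1 _ σ hσ]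
  have l3 : ((p + q : ℕ) : ℂ) * c ^ (p + q - 1) * (-σ / 2) =
      (((p + q : ℕ) : ℂ) * c ^ (p + q) / c) * (-σ / 2) := by rw [e1 _ c hc]
  rw [l3, hS, hC]
  push_cast
  generalize σ ^ (i + j) = A
  generalize c ^ (p + q) = B
  rw [h1, h2]
  field_simp
  linear_combination (-m * A * B) * hone

lemma half_angle_facts {θ : ℝ} (hθ : θ ∈ Set.Ioo 0 π) :
    ((Real.sin (θ / 2) : ℝ) : ℂ) ≠ 0 ∧ ((Real.cos (θ / 2) : ℝ) : ℂ) ≠ 0 ∧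
    ((Real.sin θ : ℝ) : ℂ) = 2 * (Real.sin (θ / 2) : ℝ) * (Real.cos (θ / 2) : ℝ) ∧
    ((Real.cos θ : ℝ) : ℂ) = ((Real.cos (θ / 2) : ℝ) : ℂ) ^ 2 - ((Real.sin (θ / 2) : ℝ) : ℂ) ^ 2 ∧
    ((Real.sin (θ / 2) : ℝ) : ℂ) ^ 2 + ((Real.cos (θ / 2) : ℝ) : ℂ) ^ 2 = 1 := by
  have h1 : 0 < Real.sin (θ / 2) :=
    Real.sin_pos_of_pos_of_lt_pi (by linarith [hθ.1]) (by linarith [hθ.1, hθ.2])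
  have h2 : 0 < Real.cos (θ / 2) :=
    Real.cos_pos_of_mem_Ioo ⟨by linarith [hθ.1, hθ.2], by linarith [hθ.1, hθ.2]⟩
  refine ⟨by exact_mod_cast h1.ne', by exact_mod_cast h2.ne', ?_, ?_, ?_⟩
  · have := Real.sin_two_mul (θ / 2)
    rw [show 2 * (θ / 2) = θ by ring] at this
    exact_mod_cast this
  · have := Real.cos_two_mul' (θ / 2)
    rw [show 2 * (θ / 2) = θ by ring] at this
    exact_mod_cast this
  · exact_mod_cast Real.sin_sq_add_cos_sq (θ / 2)

lemma differentiable_of_mem_spinSpan {s m : ℤ} {f : ℝ → ℂ} (hf : f ∈ spinSpan s m) :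
    Differentiable ℝ f := by
  induction hf using Submodule.span_induction with
  | mem f hf =>
    obtain ⟨i, p, j, q, -, -, rfl⟩ := hf
    intro θ
    exact ((hasDerivAt_ofReal_sin_half θ).differentiableAt.pow _).mul
      ((hasDerivAt_ofReal_cos_half θ).differentiableAt.pow _)
  | zero => exact differentiable_const 0
  | add f g _ _ hf hg => exact hf.add hg
  | smul a f _ hf => exact hf.const_smul a

/-- On `(0, π)`, the polar part of `ð` maps `spinSpan s m` to `spinSpan (s + 1) m`. -/
lemma exists_raise_of_mem_spinSpan {s m : ℤ} {f : ℝ → ℂ} (hf : f ∈ spinSpan s m) :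
    ∃ h ∈ spinSpan (s + 1) m, ∀ θ ∈ Set.Ioo 0 π,
      h θ = -(deriv f θ - s * ((Real.cos θ : ℝ) / (Real.sin θ : ℝ)) * f θ -
        m / (Real.sin θ : ℝ) * f θ) := by
  induction hf using Submodule.span_induction with
  | mem f hf =>
    obtain ⟨i, p, j, q, h1, h2, rfl⟩ := hf
    have k1 : (-(i : ℂ)) • (fun θ : ℝ => ((Real.sin (θ / 2) : ℝ) : ℂ) ^ (i - 1 + j) *
        ((Real.cos (θ / 2) : ℝ) : ℂ) ^ (p + (q + 1))) ∈ spinSpan (s + 1) m := by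
      rcases Nat.eq_zero_or_pos i with rfl | hi
      · simp
      · exact Submodule.smul_mem _ _ (halfAngle_mem_spinSpan (by omega) (by omega))
    have k2 : (p : ℂ) • (fun θ : ℝ => ((Real.sin (θ / 2) : ℝ) : ℂ) ^ (i + (j + 1)) *
        ((Real.cos (θ / 2) : ℝ) : ℂ) ^ (p - 1 + q)) ∈ spinSpan (s + 1) m := by
      rcases Nat.eq_zero_or_pos p with rfl | hp
      · simp
      · exact Submodule.smul_mem _ _ (halfAngle_mem_spinSpan (by omega) (by omega))
    refine ⟨_, Submodule.add_mem _ k1 k2, fun θ hθ => ?_⟩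
    obtain ⟨a1, a2, a3, a4, a5⟩ := half_angle_facts hθ
    have hd := ((hasDerivAt_ofReal_sin_half θ).fun_pow (i + j)).fun_mul
      ((hasDerivAt_ofReal_cos_half θ).fun_pow (p + q))
    rw [hd.deriv]
    have e := halfAngle_raise (i := i) (j := j) (p := p) (q := q) (s := s) (m := m) a1 a2 a3 a4 a5
      (by exact_mod_cast congrArg (Int.cast : ℤ → ℂ) h1)
      (by exact_mod_cast congrArg (Int.cast : ℤ → ℂ) h2)
    simp only [Pi.add_apply, Pi.smul_apply, smul_eq_mul]
    rw [← e]
  | zero => exact ⟨0, Submodule.zero_mem _, fun θ _ => by simp⟩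
  | add f g hf hg ihf ihg =>
    obtain ⟨h, hh, e⟩ := ihf
    obtain ⟨k, hk, e'⟩ := ihg
    refine ⟨h + k, Submodule.add_mem _ hh hk, fun θ hθ => ?_⟩
    rw [deriv_add (differentiable_of_mem_spinSpan hf θ) (differentiable_of_mem_spinSpan hg θ)]
    simp only [Pi.add_apply]
    rw [e θ hθ, e' θ hθ]
    ring
  | smul a f hf ihf =>
    obtain ⟨h, hh, e⟩ := ihf
    refine ⟨a • h, Submodule.smul_mem _ a hh, fun θ hθ => ?_⟩
    rw [deriv_const_smul a (differentiable_of_mem_spinSpan hf θ)]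
    simp only [Pi.smul_apply, smul_eq_mul]
    rw [e θ hθ]
    ring

/-- The polar part of a spin-weighted harmonic. -/
lemma exists_spinSphHarm_eq (s l m : ℤ) :
    ∃ f ∈ spinSpan s m, ∀ θ ∈ Set.Ioo 0 π, ∀ φ,
      spinSphHarm s l m θ φ = f θ * Complex.exp (Complex.I * (m : ℂ) * (φ : ℂ)) := by
  by_cases hlm : |s| ≤ l ∧ |m| ≤ l
  swap
  · exact ⟨0, Submodule.zero_mem _, fun θ _ φ => by simp [spinSphHarm, hlm]⟩
  have hs := abs_le.mp hlm.1
  have hm := abs_le.mp hlm.2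
  let K : ℝ := Real.sqrt ((2 * (l : ℝ) + 1) / (4 * Real.pi) *
          ((Nat.factorial (l + m).toNat : ℝ) * (Nat.factorial (l - m).toNat : ℝ)) /
          ((Nat.factorial (l + s).toNat : ℝ) * (Nat.factorial (l - s).toNat : ℝ)))
  let F : ℤ → ℝ → ℂ := fun r => if 0 ≤ r + s - m ∧ r + s - m ≤ l + s then
    (((((l - s).toNat.choose r.toNat : ℝ) * ((l + s).toNat.choose (r + s - m).toNat : ℝ) : ℝ) : ℂ) *
      (-1 : ℂ) ^ (l - r - s)) • (fun θ : ℝ =>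
        ((Real.sin (θ / 2) : ℝ) : ℂ) ^ ((l - s - r).toNat + (l + m - r).toNat) *
        ((Real.cos (θ / 2) : ℝ) : ℂ) ^ (r.toNat + (r + s - m).toNat)) else 0
  refine ⟨(K : ℂ) • ∑ r ∈ Finset.Icc (0 : ℤ) (l - s), F r, ?_, ?_⟩
  · refine Submodule.smul_mem _ _ (Submodule.sum_mem _ fun r hr => ?_)
    rw [Finset.mem_Icc] at hr
    by_cases hc : 0 ≤ r + s - m ∧ r + s - m ≤ l + s
    · simp only [F, if_pos hc]
      exact Submodule.smul_mem _ _ (halfAngle_mem_spinSpan (by omega) (by omega))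
    · simp only [F, if_neg hc]
      exact Submodule.zero_mem _
  · intro θ hθ φ
    obtain ⟨a1, a2, -⟩ := half_angle_facts hθ
    rw [spinSphHarm, if_pos hlm]
    simp only [Pi.smul_apply, Finset.sum_apply, smul_eq_mul]
    rw [Complex.ofReal_mul, mul_right_comm, mul_assoc ((K : ℂ))]
    congr 2
    rw [Finset.mul_sum]
    refine Finset.sum_congr rfl fun r hr => ?_
    rw [Finset.mem_Icc] at hr
    by_cases hc : 0 ≤ r + s - m ∧ r + s - m ≤ l + s
    · simp only [F, if_pos hc, Pi.smul_apply, smul_eq_mul]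
      obtain ⟨k, hk⟩ : ∃ k : ℕ, (k : ℤ) = 2 * r + s - m := ⟨(2 * r + s - m).toNat, by omega⟩
      obtain ⟨n, hn⟩ : ∃ n : ℕ, (n : ℤ) = 2 * l - (2 * r + s - m) :=
        ⟨(2 * l - (2 * r + s - m)).toNat, by omega⟩
      rw [show (l - s - r).toNat + (l + m - r).toNat = n by omega,
        show r.toNat + (r + s - m).toNat = k by omega, ← hk,
        show (2 * l).toNat = n + k by omega, zpow_natCast, Real.tan_eq_sin_div_cos]
      push_cast at a1 a2 ⊢
      rw [inv_div, div_pow, pow_add]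
      field_simp
    · simp only [F, if_neg hc, Pi.zero_apply, mul_zero]

lemma hasDerivAt_exp_azimuth (m : ℤ) (φ : ℝ) :
    HasDerivAt (fun p : ℝ => Complex.exp (Complex.I * (m : ℂ) * (p : ℂ)))
      (Complex.I * m * Complex.exp (Complex.I * (m : ℂ) * (φ : ℂ))) φ := by
  have h : HasDerivAt (fun p : ℝ => Complex.I * (m : ℂ) * (p : ℂ)) (Complex.I * m) φ := by
    simpa using (hasDerivAt_id φ).ofReal_comp.const_mul (Complex.I * (m : ℂ))
  convert h.cexp using 1
  ring

/-- `ð` acts termwise on a finite Fourier sum in the azimuth. -/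
lemma eth_sum {ι : Type*} (S : Finset ι) (m : ι → ℤ) (s : ℤ) (f : ι → ℝ → ℂ) (η : ℝ → ℝ → ℂ)
    (hf : ∀ x ∈ S, Differentiable ℝ (f x))
    (hη : ∀ θ ∈ Set.Ioo 0 π, ∀ φ,
      η θ φ = ∑ x ∈ S, f x θ * Complex.exp (Complex.I * (m x : ℂ) * (φ : ℂ)))
    {θ : ℝ} (hθ : θ ∈ Set.Ioo 0 π) (φ : ℝ) :
    eth s η θ φ = ∑ x ∈ S, -(deriv (f x) θ - s * ((Real.cos θ : ℝ) / (Real.sin θ : ℝ)) * f x θ -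
        m x / (Real.sin θ : ℝ) * f x θ) * Complex.exp (Complex.I * (m x : ℂ) * (φ : ℂ)) := by
  have hs : ((Real.sin θ : ℝ) : ℂ) ≠ 0 := by
    exact_mod_cast (Real.sin_pos_of_pos_of_lt_pi hθ.1 hθ.2).ne'
  have hφ : HasDerivAt (fun p => (((Real.sin θ : ℝ) : ℂ) ^ (-s)) * η θ p)
      (((Real.sin θ : ℝ) : ℂ) ^ (-s) * ∑ x ∈ S, f x θ *
        (Complex.I * m x * Complex.exp (Complex.I * (m x : ℂ) * (φ : ℂ)))) φ := by
    have e : (fun p => (((Real.sin θ : ℝ) : ℂ) ^ (-s)) * η θ p) = fun p : ℝ =>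
        (((Real.sin θ : ℝ) : ℂ) ^ (-s)) *
          ∑ x ∈ S, f x θ * Complex.exp (Complex.I * (m x : ℂ) * (p : ℂ)) := by
      funext p
      rw [hη θ hθ p]
    rw [e]
    exact (HasDerivAt.fun_sum fun x _ => (hasDerivAt_exp_azimuth (m x) φ).const_mul _).const_mul _
  have hz : HasDerivAt (fun t : ℝ => ((Real.sin t : ℝ) : ℂ) ^ (-s))
      (((-s : ℤ) : ℂ) * ((Real.sin θ : ℝ) : ℂ) ^ (-s - 1) * (Real.cos θ : ℝ)) θ :=
    (hasDerivAt_zpow (-s) _ (Or.inl hs)).comp_of_eq θ (hasDerivAt_ofReal_sin θ) rfl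
  have ht : HasDerivAt (fun t => (((Real.sin t : ℝ) : ℂ) ^ (-s)) * η t φ)
      (((-s : ℤ) : ℂ) * ((Real.sin θ : ℝ) : ℂ) ^ (-s - 1) * (Real.cos θ : ℝ) *
          (∑ x ∈ S, f x θ * Complex.exp (Complex.I * (m x : ℂ) * (φ : ℂ))) +
        ((Real.sin θ : ℝ) : ℂ) ^ (-s) *
          ∑ x ∈ S, deriv (f x) θ * Complex.exp (Complex.I * (m x : ℂ) * (φ : ℂ))) θ := by
    refine (hz.fun_mul (HasDerivAt.fun_sum fun x hx =>
      ((hf x hx) θ).hasDerivAt.mul_const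
        (Complex.exp (Complex.I * (m x : ℂ) * (φ : ℂ))))).congr_of_eventuallyEq ?_
    filter_upwards [Ioo_mem_nhds hθ.1 hθ.2] with t ht
    rw [hη t ht φ]
  rw [eth, hφ.deriv, ht.deriv, zpow_sub_one₀ hs, zpow_neg]
  have hz' : ((Real.sin θ : ℝ) : ℂ) ^ s ≠ 0 := zpow_ne_zero _ hs
  generalize ((Real.sin θ : ℝ) : ℂ) ^ s = A at *
  generalize ((Real.sin θ : ℝ) : ℂ) = B at *
  generalize ((Real.cos θ : ℝ) : ℂ) = C at *
  have e : ∀ X Y Z : ℂ, -A * (((-s : ℤ) : ℂ) * (A⁻¹ * B⁻¹) * C * X + A⁻¹ * Y + Complex.I / B * (A⁻¹ * Z))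
      = (s * (C / B)) * X + -1 * Y + (-(Complex.I / B)) * Z := by
    intro X Y Z
    push_cast
    field_simp
    ring
  rw [e, Finset.mul_sum, Finset.mul_sum, Finset.mul_sum, ← Finset.sum_add_distrib,
    ← Finset.sum_add_distrib]
  refine Finset.sum_congr rfl fun x _ => ?_
  linear_combination (-(m x : ℂ) / B * f x θ * Complex.exp (Complex.I * (m x : ℂ) * (φ : ℂ))) *
    Complex.I_sq

lemma ethBar_eq_eth (s : ℤ) (η : ℝ → ℝ → ℂ) (θ φ : ℝ) :
    ethBar s η θ φ = eth (-s) (fun t p => η t (-p)) θ (-φ) := by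
  have h := deriv_comp_neg (fun p => (((Real.sin θ : ℝ) : ℂ) ^ s) * η θ p) (-φ)
  simp only [neg_neg] at h
  simp only [ethBar, eth, neg_neg, h]
  ring

/-- A polar profile `g` whose product with `e^{imφ}` is annihilated by `ð²`, with `g₁` the
profile of the intermediate field. -/
def IsEthSqKernel (m : ℤ) (g : ℝ → ℂ) : Prop :=
  ∃ g' g₁ g₁' : ℝ → ℂ, (∀ θ, HasDerivAt g (g' θ) θ) ∧ (∀ θ, HasDerivAt g₁ (g₁' θ) θ) ∧
    (∀ θ, g₁ θ * (Real.sin θ : ℝ) = g' θ * (Real.sin θ : ℝ) + m * g θ) ∧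
    ∀ θ, (Real.cos θ : ℝ) * g₁ θ - m * g₁ θ - (Real.sin θ : ℝ) * g₁' θ = 0

lemma IsEthSqKernel.const_mul {m : ℤ} {g : ℝ → ℂ} (h : IsEthSqKernel m g) (κ : ℂ) :
    IsEthSqKernel m (fun θ => κ * g θ) := by
  obtain ⟨g', g₁, g₁', h1, h2, h3, h4⟩ := h
  refine ⟨fun θ => κ * g' θ, fun θ => κ * g₁ θ, fun θ => κ * g₁' θ,
    fun θ => (h1 θ).const_mul κ, fun θ => (h2 θ).const_mul κ, fun θ => ?_, fun θ => ?_⟩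
  · linear_combination κ * h3 θ
  · linear_combination κ * h4 θ

lemma isEthSqKernel_one : IsEthSqKernel 0 (fun _ => 1) :=
  ⟨fun _ => 0, fun _ => 0, fun _ => 0, fun θ => hasDerivAt_const _ _,
    fun θ => hasDerivAt_const _ _, by simp, by simp⟩

lemma isEthSqKernel_cos : IsEthSqKernel 0 (fun θ => ((Real.cos θ : ℝ) : ℂ)) :=
  ⟨_, _, _, hasDerivAt_ofReal_cos, fun θ => (hasDerivAt_ofReal_sin θ).fun_neg,
    fun θ => by simp, fun θ => by push_cast; ring⟩

lemma isEthSqKernel_sin {m : ℤ} (hm : m ^ 2 = 1) :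
    IsEthSqKernel m (fun θ => ((Real.sin θ : ℝ) : ℂ)) := by
  refine ⟨_, _, _, hasDerivAt_ofReal_sin, fun θ => (hasDerivAt_ofReal_cos θ).add_const (m : ℂ),
    fun θ => by ring, fun θ => ?_⟩
  have h : ((Real.sin θ : ℝ) : ℂ) ^ 2 + ((Real.cos θ : ℝ) : ℂ) ^ 2 = 1 := by
    exact_mod_cast Real.sin_sq_add_cos_sq θ
  have h' : (m : ℂ) ^ 2 = 1 := by exact_mod_cast hm
  linear_combination h - h'

/-- `ð²` of a spin-weight `-2` profile is orthogonal to the kernel of the adjoint of `ð²`. -/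
lemma integral_raise_raise_eq_zero {m : ℤ} {f h Z g : ℝ → ℂ} (hf : Differentiable ℝ f)
    (hh : Differentiable ℝ h) (hZ : Continuous Z) (hg : IsEthSqKernel m g)
    (e1 : ∀ θ ∈ Set.Ioo 0 π, h θ = -(deriv f θ - (-2 : ℤ) *
      ((Real.cos θ : ℝ) / (Real.sin θ : ℝ)) * f θ - m / (Real.sin θ : ℝ) * f θ))
    (e2 : ∀ θ ∈ Set.Ioo 0 π, Z θ = -(deriv h θ - (-1 : ℤ) *
      ((Real.cos θ : ℝ) / (Real.sin θ : ℝ)) * h θ - m / (Real.sin θ : ℝ) * h θ)) :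
    ∫ θ in (0 : ℝ)..π, Z θ * g θ * ((Real.sin θ : ℝ) : ℂ) = 0 := by
  obtain ⟨g', g₁, g₁', h1, h2, h3, h4⟩ := hg
  have hgc : Continuous g := continuous_iff_continuousAt.mpr fun θ => (h1 θ).continuousAt
  have hsc : Continuous fun θ : ℝ => ((Real.sin θ : ℝ) : ℂ) :=
    Complex.continuous_ofReal.comp Real.continuous_sin
  have hG : ∀ θ, HasDerivAt
      (fun θ => -((h θ * g θ + f θ * g₁ θ) * ((Real.sin θ : ℝ) : ℂ)))
      (-(((deriv h θ * g θ + h θ * g' θ) + (deriv f θ * g₁ θ + f θ * g₁' θ)) *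
        ((Real.sin θ : ℝ) : ℂ) + (h θ * g θ + f θ * g₁ θ) * ((Real.cos θ : ℝ) : ℂ))) θ :=
    fun θ => ((((hh θ).hasDerivAt.fun_mul (h1 θ)).fun_add
      ((hf θ).hasDerivAt.fun_mul (h2 θ))).fun_mul (hasDerivAt_ofReal_sin θ)).fun_neg
  rw [intervalIntegral.integral_eq_sub_of_hasDerivAt_of_le Real.pi_pos.le
    (f := fun θ => -((h θ * g θ + f θ * g₁ θ) * ((Real.sin θ : ℝ) : ℂ)))
    (f' := fun θ => Z θ * g θ * ((Real.sin θ : ℝ) : ℂ))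
    (fun θ _ => (hG θ).continuousAt.continuousWithinAt) ?_
    (((hZ.mul hgc).mul hsc).intervalIntegrable _ _)]
  · simp
  · intro θ hθ
    refine (hG θ).congr_deriv ?_
    have hs : ((Real.sin θ : ℝ) : ℂ) ≠ 0 := by
      exact_mod_cast (Real.sin_pos_of_pos_of_lt_pi hθ.1 hθ.2).ne'
    have E1 : h θ * (Real.sin θ : ℝ) = -(deriv f θ * (Real.sin θ : ℝ) +
        2 * (Real.cos θ : ℝ) * f θ - m * f θ) := by
      rw [e1 θ hθ]
      push_cast at hs ⊢
      field_simp
      ring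
    have E2 : Z θ * (Real.sin θ : ℝ) = -(deriv h θ * (Real.sin θ : ℝ) +
        (Real.cos θ : ℝ) * h θ - m * h θ) := by
      rw [e2 θ hθ]
      push_cast at hs ⊢
      field_simp
      ring
    linear_combination -g θ * E2 + h θ * h3 θ - g₁ θ * E1 + f θ * h4 θ

lemma exists_conj_sphHarm_eq {l : ℤ} (hl : l = 0 ∨ l = 1) {m : ℤ} (hm : |m| ≤ l) :
    ∃ g : ℝ → ℂ, IsEthSqKernel m g ∧ IsEthSqKernel (-m) g ∧ ∀ θ ∈ Set.Ioo 0 π, ∀ φ,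
      (starRingEnd ℂ) (sphHarm l m θ φ) =
        g θ * Complex.exp (Complex.I * ((-m : ℤ) : ℂ) * (φ : ℂ)) := by
  have key : ∀ (κ : ℝ) (g : ℝ → ℝ), IsEthSqKernel m (fun θ => (g θ : ℂ)) →
      IsEthSqKernel (-m) (fun θ => (g θ : ℂ)) →
      (∀ θ ∈ Set.Ioo 0 π, assocLegendre l.toNat m (Real.cos θ) = κ * g θ) →
      ∃ g : ℝ → ℂ, IsEthSqKernel m g ∧ IsEthSqKernel (-m) g ∧ ∀ θ ∈ Set.Ioo 0 π, ∀ φ,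
        (starRingEnd ℂ) (sphHarm l m θ φ) =
          g θ * Complex.exp (Complex.I * ((-m : ℤ) : ℂ) * (φ : ℂ)) := by
    intro κ g hg hg' e
    have hl0 : 0 ≤ l ∧ |m| ≤ l := ⟨by omega, hm⟩
    let N : ℝ := Real.sqrt ((2 * (l : ℝ) + 1) / (4 * Real.pi) *
        ((Nat.factorial (l - m).toNat : ℝ) / (Nat.factorial (l + m).toNat : ℝ)))
    refine ⟨fun θ => ((N * κ : ℝ) : ℂ) * g θ, hg.const_mul _, hg'.const_mul _, fun θ hθ φ => ?_⟩
    rw [sphHarm, if_pos hl0, e θ hθ, map_mul, Complex.conj_ofReal, ← Complex.exp_conj]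
    simp only [map_mul, Complex.conj_I, Complex.conj_ofReal, map_intCast]
    push_cast
    rw [show -Complex.I * (m : ℂ) * (φ : ℂ) = Complex.I * -(m : ℂ) * φ by ring]
    ring
  have hP0 : legendreP 0 = fun _ => 1 := by
    funext x
    simp [legendreP]
  have hP1 : legendreP 1 = fun x => x := by
    funext x
    simp [legendreP, iteratedDeriv_one]
  have hsq : ∀ θ ∈ Set.Ioo 0 π, Real.sqrt (1 - Real.cos θ ^ 2) = Real.sin θ := by
    intro θ hθ
    rw [← Real.abs_sin_eq_sqrt_one_sub_cos_sq,
      abs_of_pos (Real.sin_pos_of_pos_of_lt_pi hθ.1 hθ.2)]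
  have hm' := abs_le.mp hm
  rcases hl with rfl | rfl
  · obtain rfl : m = 0 := by omega
    refine key 1 (fun _ => 1) ?_ ?_ ?_
    · simpa using isEthSqKernel_one
    · simpa using isEthSqKernel_one
    · intro θ _
      simp [assocLegendre, assocLegendreNat, hP0]
  · obtain rfl | rfl | rfl : m = 0 ∨ m = 1 ∨ m = -1 := by omega
    · refine key 1 Real.cos isEthSqKernel_cos (by simpa using isEthSqKernel_cos) ?_
      intro θ _
      simp [assocLegendre, assocLegendreNat, hP1]
    · refine key (-1) Real.sin (isEthSqKernel_sin (by norm_num)) (isEthSqKernel_sin (by norm_num)) ?_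
      intro θ hθ
      simp [assocLegendre, assocLegendreNat, hP1, hsq θ hθ, iteratedDeriv_one]
    · refine key (1 / 2) Real.sin (isEthSqKernel_sin (by norm_num))
        (isEthSqKernel_sin (by norm_num)) ?_
      intro θ hθ
      simp [assocLegendre, assocLegendreNat, hP1, hsq θ hθ, iteratedDeriv_one]

lemma integral_exp_azimuth {n : ℤ} (hn : n ≠ 0) :
    ∫ φ in (0 : ℝ)..(2 * π), Complex.exp (Complex.I * (n : ℂ) * (φ : ℂ)) = 0 := by
  have hc : Complex.I * (n : ℂ) ≠ 0 := mul_ne_zero Complex.I_ne_zero (by exact_mod_cast hn)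
  rw [integral_exp_mul_complex hc]
  have : Complex.I * (n : ℂ) * ((2 * π : ℝ) : ℂ) = n * (2 * π * Complex.I) := by
    push_cast
    ring
  rw [this, Complex.exp_int_mul_two_pi_mul_I]
  simp

/-- The sphere integral of a finite Fourier sum only sees its zero mode. -/
lemma sphereIntegral_eq_zero_of_sum {ι : Type*} (S : Finset ι) (n : ι → ℤ) (W : ι → ℝ → ℂ)
    (F : ℝ → ℝ → ℂ) (hW : ∀ x ∈ S, Continuous (W x))
    (h0 : ∀ x ∈ S, n x = 0 → ∫ θ in (0 : ℝ)..π, W x θ * ((Real.sin θ : ℝ) : ℂ) = 0)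
    (hF : ∀ θ ∈ Set.Ioo 0 π, ∀ φ,
      F θ φ = ∑ x ∈ S, W x θ * Complex.exp (Complex.I * (n x : ℂ) * (φ : ℂ))) :
    sphereIntegral F = 0 := by
  have hsc : Continuous fun θ : ℝ => ((Real.sin θ : ℝ) : ℂ) :=
    Complex.continuous_ofReal.comp Real.continuous_sin
  have inner : ∀ φ : ℝ, ∫ θ in (0 : ℝ)..π, F θ φ * ((Real.sin θ : ℝ) : ℂ) =
      ∑ x ∈ S, (∫ θ in (0 : ℝ)..π, W x θ * ((Real.sin θ : ℝ) : ℂ)) *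
        Complex.exp (Complex.I * (n x : ℂ) * (φ : ℂ)) := by
    intro φ
    have : ∫ θ in (0 : ℝ)..π, F θ φ * ((Real.sin θ : ℝ) : ℂ) =
        ∫ θ in (0 : ℝ)..π, ∑ x ∈ S, W x θ * ((Real.sin θ : ℝ) : ℂ) *
          Complex.exp (Complex.I * (n x : ℂ) * (φ : ℂ)) := by
      rw [intervalIntegral.integral_of_le Real.pi_pos.le,
        intervalIntegral.integral_of_le Real.pi_pos.le,
        MeasureTheory.integral_Ioc_eq_integral_Ioo, MeasureTheory.integral_Ioc_eq_integral_Ioo]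
      refine MeasureTheory.setIntegral_congr_fun measurableSet_Ioo fun θ hθ => ?_
      simp only [hF θ hθ φ, Finset.sum_mul]
      exact Finset.sum_congr rfl fun x _ => by ring
    rw [this, intervalIntegral.integral_finsetSum]
    · exact Finset.sum_congr rfl fun x _ => intervalIntegral.integral_mul_const _ _
    · exact fun x hx => (((hW x hx).mul hsc).mul continuous_const).intervalIntegrable _ _
  rw [sphereIntegral]
  simp only [inner]
  rw [intervalIntegral.integral_finsetSum]
  · refine Finset.sum_eq_zero fun x hx => ?_
    rw [intervalIntegral.integral_const_mul]
    by_cases hn : n x = 0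
    · rw [h0 x hx hn, zero_mul]
    · rw [integral_exp_azimuth hn, mul_zero]
  · intro x _
    refine Continuous.intervalIntegrable ?_ _ _
    fun_prop

/-- Applying `ð²` to a finite sum of spin-weight `-2` modes. -/
lemma exists_eth_eth_sum {ι : Type*} (S : Finset ι) (m : ι → ℤ) (f : ι → ℝ → ℂ) (η : ℝ → ℝ → ℂ)
    (hf : ∀ x, f x ∈ spinSpan (-2) (m x))
    (hη : ∀ θ ∈ Set.Ioo 0 π, ∀ φ,
      η θ φ = ∑ x ∈ S, f x θ * Complex.exp (Complex.I * (m x : ℂ) * (φ : ℂ))) :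
    ∃ Z : ι → ℝ → ℂ, (∀ x, Continuous (Z x)) ∧
      (∀ x g, IsEthSqKernel (m x) g →
        ∫ θ in (0 : ℝ)..π, Z x θ * g θ * ((Real.sin θ : ℝ) : ℂ) = 0) ∧
      ∀ θ ∈ Set.Ioo 0 π, ∀ φ, eth (-1) (eth (-2) η) θ φ =
        ∑ x ∈ S, Z x θ * Complex.exp (Complex.I * (m x : ℂ) * (φ : ℂ)) := by
  choose h hh eh using fun x => exists_raise_of_mem_spinSpan (hf x)
  norm_num at hh
  choose Z hZ eZ using fun x => exists_raise_of_mem_spinSpan (hh x)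
  have dh := fun x => differentiable_of_mem_spinSpan (hh x)
  have df := fun x => differentiable_of_mem_spinSpan (hf x)
  have cZ := fun x => (differentiable_of_mem_spinSpan (hZ x)).continuous
  refine ⟨Z, cZ, fun x g hg =>
    integral_raise_raise_eq_zero (df x) (dh x) (cZ x) hg (eh x) (eZ x), fun θ hθ φ => ?_⟩
  rw [eth_sum S m (-1) h _ (fun x _ => dh x) ?_ hθ φ]
  · exact Finset.sum_congr rfl fun x _ => by rw [eZ x θ hθ]
  · intro t ht p
    rw [eth_sum S m (-2) f _ (fun x _ => df x) hη ht p]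
    exact Finset.sum_congr rfl fun x _ => by rw [eh x t ht]

/-- **Vanishing of the low multipoles of the E-mode field.**
If `Q ± iU` are band-limited spin `±2` fields and
`E = -(1/2) [ð²(Q - iU) + ð̄²(Q + iU)]`, then `E_{lm} = 0` for `l = 0, 1`. -/
theorem E_mode_low_multipoles_vanish
    (L : ℤ) (hL : 2 ≤ L) (a2 am2 : ℤ → ℤ → ℂ) (QpiU QmiU : ℝ → ℝ → ℂ)
    (hQp : QpiU = fun θ φ => ∑ l ∈ Finset.Icc (2 : ℤ) L, ∑ m ∈ Finset.Icc (-l) l,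
      a2 l m * spinSphHarm 2 l m θ φ)
    (hQm : QmiU = fun θ φ => ∑ l ∈ Finset.Icc (2 : ℤ) L, ∑ m ∈ Finset.Icc (-l) l,
      am2 l m * spinSphHarm (-2) l m θ φ)
    (E : ℝ → ℝ → ℂ)
    (hE : E = fun θ φ => -(1 / 2 : ℂ) *
      (eth (-1) (eth (-2) QmiU) θ φ + ethBar 1 (ethBar 2 QpiU) θ φ)) :
    ∀ l : ℤ, (l = 0 ∨ l = 1) → ∀ m : ℤ, |m| ≤ l →
      sphereIntegral (fun θ φ => E θ φ * (starRingEnd ℂ) (sphHarm l m θ φ)) = 0 := by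
  intro l hl m hm
  obtain ⟨g, hg, hg', eg⟩ := exists_conj_sphHarm_eq hl hm
  let S : Finset (Σ _ : ℤ, ℤ) := (Finset.Icc (2 : ℤ) L).sigma fun l => Finset.Icc (-l) l
  choose fm hfm em using fun x : (Σ _ : ℤ, ℤ) => exists_spinSphHarm_eq (-2) x.1 x.2
  choose fp hfp ep using fun x : (Σ _ : ℤ, ℤ) => exists_spinSphHarm_eq 2 x.1 x.2
  obtain ⟨Zm, cZm, oZm, eZm⟩ := exists_eth_eth_sum S (fun x => x.2)
    (fun x => am2 x.1 x.2 • fm x) QmiU (fun x => Submodule.smul_mem _ _ (hfm x)) (by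
      intro θ hθ φ
      simp only [hQm]
      rw [Finset.sum_sigma']
      refine Finset.sum_congr rfl fun x _ => ?_
      rw [em x θ hθ φ, Pi.smul_apply, smul_eq_mul]
      ring)
  obtain ⟨Zp, cZp, oZp, eZp⟩ := exists_eth_eth_sum S (fun x => -x.2)
    (fun x => a2 x.1 x.2 • fp x) (fun θ φ => QpiU θ (-φ))
    (fun x => Submodule.smul_mem _ _ (spinSpan_neg_le _ _ (hfp x))) (by
      intro θ hθ φ
      simp only [hQp]
      rw [Finset.sum_sigma']
      refine Finset.sum_congr rfl fun x _ => ?_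
      rw [ep x θ hθ (-φ), Pi.smul_apply, smul_eq_mul]
      push_cast
      rw [show Complex.I * -(x.2 : ℂ) * (φ : ℂ) = Complex.I * (x.2 : ℂ) * -(φ : ℂ) by ring]
      ring)
  have hbar : ∀ θ φ, ethBar 1 (ethBar 2 QpiU) θ φ =
      eth (-1) (eth (-2) fun θ φ => QpiU θ (-φ)) θ (-φ) := by
    intro θ φ
    rw [ethBar_eq_eth]
    simp only [ethBar_eq_eth 2 QpiU, neg_neg]
  have hgc : Continuous g := by
    obtain ⟨g', -, -, h1, -⟩ := hg
    exact continuous_iff_continuousAt.mpr fun θ => (h1 θ).continuousAt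
  have hsc : Continuous fun θ : ℝ => ((Real.sin θ : ℝ) : ℂ) :=
    Complex.continuous_ofReal.comp Real.continuous_sin
  refine sphereIntegral_eq_zero_of_sum S (fun x => x.2 - m)
    (fun x θ => -(1 / 2 : ℂ) * (Zm x θ * g θ + Zp x θ * g θ)) _ ?_ ?_ ?_
  · exact fun x _ => continuous_const.mul (((cZm x).mul hgc).add ((cZp x).mul hgc))
  · intro x _ hx
    have hx' : x.2 = m := by linarith
    have h1 := oZm x g (by simpa only [hx'] using hg)
    have h2 := oZp x g (by simpa only [hx'] using hg')
    simp only [mul_assoc, add_mul] at h1 h2 ⊢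
    rw [intervalIntegral.integral_const_mul, intervalIntegral.integral_add, h1, h2]
    · simp
    · exact ((cZm x).mul (hgc.mul hsc)).intervalIntegrable _ _
    · exact ((cZp x).mul (hgc.mul hsc)).intervalIntegrable _ _
  · intro θ hθ φ
    rw [hE]
    simp only [hbar, eZm θ hθ φ, eZp θ hθ (-φ), eg θ hθ φ]
    rw [← Finset.sum_add_distrib, Finset.mul_sum, Finset.sum_mul]
    refine Finset.sum_congr rfl fun x _ => ?_
    have e1 : Complex.exp (Complex.I * ((-x.2 : ℤ) : ℂ) * ((-φ : ℝ) : ℂ)) =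
        Complex.exp (Complex.I * (x.2 : ℂ) * (φ : ℂ)) := by
      push_cast
      congr 1
      ring
    have e2 : Complex.exp (Complex.I * ((x.2 - m : ℤ) : ℂ) * (φ : ℂ)) =
        Complex.exp (Complex.I * (x.2 : ℂ) * (φ : ℂ)) *
          Complex.exp (Complex.I * ((-m : ℤ) : ℂ) * (φ : ℂ)) := by
      rw [← Complex.exp_add]
      push_cast
      congr 1
      ring
    rw [e1, e2]
    ring
end

section
/- Let s, l, m be integers with l ≥ max(|s|, |s+1|) and |m| ≤ l. Then applying the spin-raising operator at spin weight s to the spin-weighted spherical harmonic Y_{s,lm} gives ð Y_{s,lm} = √((l−s)(l+s+1))·Y_{s+1,lm} on the open set 0 < θ < π. -/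
open scoped Real
open Complex

/-- The binomial coefficient `n.choose j` as a real number, extended by `0` to negative `j`. -/
def intChoose (n : ℕ) (j : ℤ) : ℝ := if 0 ≤ j then (n.choose j.toNat : ℝ) else 0

theorem intChoose_succ_succ (n : ℕ) (j : ℤ) :
    intChoose (n + 1) (j + 1) = intChoose n j + intChoose n (j + 1) := by
  unfold intChoose
  rcases lt_trichotomy j (-1) with h | rfl | h
  · simp [show ¬ 0 ≤ j by omega, show ¬ 0 ≤ j + 1 by omega]
  · simp
  · lift j to ℕ using by omega
    simp [show (0 : ℤ) ≤ j + 1 by omega, show ((j : ℤ) + 1).toNat = j + 1 by omega,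
      Nat.choose_succ_succ]

/-- The coefficient of `cot (θ / 2) ^ (2 * r + d)` in a spin-weighted spherical harmonic with
`l - s = N`, `l + s = M` and `s - m = d`. -/
def cotCoeff (N M : ℕ) (d : ℤ) (r : ℕ) : ℝ :=
  N.choose r * intChoose M (r + d) * (-1) ^ (N + r)

/-- The normalisation factor of a spin-weighted spherical harmonic with `l - s = N`, `l + s = M`. -/
noncomputable def spinNorm (l m : ℤ) (N M : ℕ) : ℝ :=
  Real.sqrt ((2 * (l : ℝ) + 1) / (4 * Real.pi) *
    ((Nat.factorial (l + m).toNat : ℝ) * (Nat.factorial (l - m).toNat : ℝ)) /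
    ((Nat.factorial M : ℝ) * (Nat.factorial N : ℝ)))

theorem spinSphHarm_eq_sum {s l m : ℤ} {N M L : ℕ} (hN : l - s = N) (hM : l + s = M)
    (hL : l = L) (hm : |m| ≤ l) (θ φ : ℝ) :
    spinSphHarm s l m θ φ =
      ((spinNorm l m N M * ∑ r ∈ Finset.range (N + 1), cotCoeff N M (s - m) r *
        (Real.sin (θ / 2) ^ (2 * L) * (Real.tan (θ / 2))⁻¹ ^ (2 * (r : ℤ) + s - m)) : ℝ) : ℂ) *
        Complex.exp (Complex.I * (m : ℂ) * (φ : ℂ)) := by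
  have hs : |s| ≤ l := abs_le.2 ⟨by omega, by omega⟩
  have hsum : (∑ r ∈ Finset.Icc (0 : ℤ) (l - s),
      if 0 ≤ r + s - m ∧ r + s - m ≤ l + s then
        ((((l - s).toNat.choose r.toNat : ℝ) *
          ((l + s).toNat.choose (r + s - m).toNat : ℝ) : ℝ) : ℂ) *
          (-1 : ℂ) ^ (l - r - s) * ((((Real.tan (θ / 2))⁻¹ : ℝ) ^ (2 * r + s - m) : ℝ) : ℂ)
      else 0) = ((∑ r ∈ Finset.range (N + 1), cotCoeff N M (s - m) r *
        (Real.tan (θ / 2))⁻¹ ^ (2 * (r : ℤ) + s - m) : ℝ) : ℂ) := by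
    rw [Complex.ofReal_sum]
    refine Finset.sum_nbij' Int.toNat (fun r : ℕ => (r : ℤ)) ?_ ?_ ?_ ?_ ?_
    · intro r hr
      simp only [Finset.mem_Icc, Finset.mem_range] at hr ⊢
      omega
    · intro r hr
      simp only [Finset.mem_Icc, Finset.mem_range] at hr ⊢
      omega
    · intro r hr
      simp only [Finset.mem_Icc] at hr
      simp [hr.1]
    · intro r _
      simp
    · intro r hr
      simp only [Finset.mem_Icc] at hr
      lift r to ℕ using hr.1
      have hsign : (-1 : ℂ) ^ (l - r - s) = (-1) ^ (N + r) := by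
        rw [show l - r - s = ((N + r : ℕ) : ℤ) - 2 * r by push_cast; omega,
          zpow_sub₀ (by norm_num), zpow_mul, zpow_natCast]
        simp
      rw [hsign, hN, hM]
      simp only [Int.toNat_natCast]
      unfold cotCoeff intChoose
      by_cases h0 : 0 ≤ (r : ℤ) + s - m
      · by_cases h1 : (r : ℤ) + s - m ≤ M
        · rw [if_pos ⟨h0, h1⟩, if_pos (show 0 ≤ (r : ℤ) + (s - m) by omega),
            show (r : ℤ) + (s - m) = r + s - m by ring]
          push_cast
          simp
        · have : M.choose ((r : ℤ) + (s - m)).toNat = 0 := Nat.choose_eq_zero_of_lt (by omega)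
          simp [h1, this]
      · rw [if_neg (fun h => h0 h.1), if_neg (show ¬ 0 ≤ (r : ℤ) + (s - m) by omega)]
        simp
  unfold spinSphHarm
  rw [if_pos ⟨hs, hm⟩, hsum, hN, hM, show (2 * l).toNat = 2 * L by omega]
  simp only [Int.toNat_natCast]
  have : ∑ r ∈ Finset.range (N + 1), cotCoeff N M (s - m) r *
        (Real.sin (θ / 2) ^ (2 * L) * (Real.tan (θ / 2))⁻¹ ^ (2 * (r : ℤ) + s - m)) =
      Real.sin (θ / 2) ^ (2 * L) * ∑ r ∈ Finset.range (N + 1), cotCoeff N M (s - m) r *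
        (Real.tan (θ / 2))⁻¹ ^ (2 * (r : ℤ) + s - m) := by
    rw [Finset.mul_sum]
    exact Finset.sum_congr rfl fun r _ => by ring
  rw [this]
  unfold spinNorm
  push_cast
  ring

/-- The action of `ð` on a function whose dependence on the longitude is `exp (i m φ)`. -/
theorem eth_mul_exp (s m : ℤ) {g : ℝ → ℝ} {g' θ : ℝ} (hg : HasDerivAt g g' θ)
    (hθ : Real.sin θ ≠ 0) (φ : ℝ) :
    eth s (fun t p => (g t : ℂ) * Complex.exp (Complex.I * (m : ℂ) * (p : ℂ))) θ φ =
      ((-(g' - (s * Real.cos θ + m) / Real.sin θ * g θ) : ℝ) : ℂ) *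
        Complex.exp (Complex.I * (m : ℂ) * (φ : ℂ)) := by
  have hS : ((Real.sin θ : ℝ) : ℂ) ≠ 0 := by exact_mod_cast hθ
  have h1 : HasDerivAt (fun t : ℝ => ((Real.sin t : ℝ) : ℂ) ^ (-s))
      (((-s : ℤ) : ℂ) * ((Real.sin θ : ℝ) : ℂ) ^ (-s - 1) * ((Real.cos θ : ℝ) : ℂ)) θ :=
    HasDerivAt.comp (h₂ := fun z : ℂ => z ^ (-s)) (h := fun t : ℝ => ((Real.sin t : ℝ) : ℂ)) θ
      (hasDerivAt_zpow (-s) ((Real.sin θ : ℝ) : ℂ) (Or.inl hS))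
      (Real.hasDerivAt_sin θ).ofReal_comp
  have h2 := h1.mul (hg.ofReal_comp.mul_const (Complex.exp (Complex.I * (m : ℂ) * (φ : ℂ))))
  have h3 : HasDerivAt (fun p : ℝ => Complex.exp (Complex.I * (m : ℂ) * (p : ℂ)))
      (Complex.exp (Complex.I * (m : ℂ) * (φ : ℂ)) * (Complex.I * (m : ℂ))) φ := by
    simpa using ((hasDerivAt_id φ).ofReal_comp.const_mul (Complex.I * (m : ℂ))).cexp
  have h4 := (h3.const_mul (g θ : ℂ)).const_mul (((Real.sin θ : ℝ) : ℂ) ^ (-s))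
  have e2 := h2.deriv
  have e4 := h4.deriv
  simp only [eth]
  erw [e2, e4]
  rw [zpow_sub_one₀ hS, zpow_neg]
  have hz := zpow_ne_zero s hS
  push_cast at hS hz ⊢
  field_simp
  linear_combination (-(m : ℂ) * (g θ : ℂ)) * Complex.I_sq

theorem hasDerivAt_inv_tan_half {θ : ℝ} (h0 : 0 < θ) (hpi : θ < Real.pi) :
    HasDerivAt (fun t : ℝ => (Real.tan (t / 2))⁻¹)
      (-(1 + (Real.tan (θ / 2))⁻¹ ^ 2) / 2) θ := by
  have hs : Real.sin (θ / 2) ≠ 0 := (Real.sin_pos_of_pos_of_lt_pi (by linarith) (by linarith)).ne'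
  have hc : Real.cos (θ / 2) ≠ 0 := (Real.cos_pos_of_mem_Ioo ⟨by linarith, by linarith⟩).ne'
  have ht : Real.tan (θ / 2) ≠ 0 := by
    rw [Real.tan_eq_sin_div_cos]; exact div_ne_zero hs hc
  have h := (HasDerivAt.comp (h := fun t : ℝ => t / 2) θ (Real.hasDerivAt_tan hc)
    ((hasDerivAt_id θ).div_const 2)).inv ht
  refine h.congr_deriv ?_
  simp only [Function.comp_apply]
  rw [Real.tan_eq_sin_div_cos]
  field_simp
  linear_combination Real.sin_sq_add_cos_sq (θ / 2)

theorem hasDerivAt_sin_half_pow_mul_inv_tan_half_zpow {θ : ℝ} (h0 : 0 < θ) (hpi : θ < Real.pi)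
    (L : ℕ) (k : ℤ) :
    HasDerivAt (fun t : ℝ => Real.sin (t / 2) ^ (2 * L) * (Real.tan (t / 2))⁻¹ ^ k)
      (Real.sin (θ / 2) ^ (2 * L) * ((L - k / 2) * (Real.tan (θ / 2))⁻¹ ^ (k + 1) -
        k / 2 * (Real.tan (θ / 2))⁻¹ ^ (k - 1))) θ := by
  have hs : Real.sin (θ / 2) ≠ 0 := (Real.sin_pos_of_pos_of_lt_pi (by linarith) (by linarith)).ne'
  have hc : Real.cos (θ / 2) ≠ 0 := (Real.cos_pos_of_mem_Ioo ⟨by linarith, by linarith⟩).ne'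
  have hx : (Real.tan (θ / 2))⁻¹ ≠ 0 := by
    rw [Real.tan_eq_sin_div_cos]; exact inv_ne_zero (div_ne_zero hs hc)
  have hcos : Real.cos (θ / 2) = Real.sin (θ / 2) * (Real.tan (θ / 2))⁻¹ := by
    rw [Real.tan_eq_sin_div_cos]; field_simp
  have h1 : HasDerivAt (fun t : ℝ => Real.sin (t / 2) ^ (2 * L))
      (L * Real.sin (θ / 2) ^ (2 * L) * (Real.tan (θ / 2))⁻¹) θ := by
    have h := (((Real.hasDerivAt_sin (θ / 2)).comp θ ((hasDerivAt_id θ).div_const 2))).pow (2 * L)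
    refine h.congr_deriv ?_
    simp only [Function.comp_apply, id]
    rw [hcos]
    rcases L with _ | L
    · simp
    · rw [show 2 * (L + 1) - 1 = 2 * L + 1 by omega]
      push_cast
      ring
  have h2 := (hasDerivAt_zpow k _ (Or.inl hx)).comp θ (hasDerivAt_inv_tan_half h0 hpi)
  refine (h1.mul h2).congr_deriv ?_
  simp only [Function.comp_apply]
  rw [zpow_add_one₀ hx, zpow_sub_one₀ hx]
  generalize (Real.tan (θ / 2))⁻¹ = x at hx ⊢
  field_simp
  ring

theorem sum_cotCoeff_raise (n M : ℕ) (d : ℤ) (x : ℝ) :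
    ∑ r ∈ Finset.range (n + 2), cotCoeff (n + 1) M d r *
        (r * x ^ (2 * (r : ℤ) + d - 1) - (n + 1 - r) * x ^ (2 * (r : ℤ) + d + 1)) =
      (n + 1) * ∑ r ∈ Finset.range (n + 1), cotCoeff n (M + 1) (d + 1) r *
        x ^ (2 * (r : ℤ) + d + 1) := by
  simp only [mul_sub, Finset.sum_sub_distrib]
  rw [Finset.sum_range_succ' _ (n + 1), Finset.sum_range_succ (fun r : ℕ =>
    cotCoeff (n + 1) M d r * ((n + 1 - r) * x ^ (2 * (r : ℤ) + d + 1)))]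
  have hz : (n + 1 - ((n + 1 : ℕ) : ℝ)) = 0 := by push_cast; ring
  rw [hz]
  simp only [Nat.cast_zero, zero_mul, mul_zero, add_zero]
  rw [← Finset.sum_sub_distrib, Finset.mul_sum]
  refine Finset.sum_congr rfl fun r hr => ?_
  have hr' : r ≤ n := by simpa [Nat.lt_succ_iff] using hr
  have e1 : ((n + 1).choose (r + 1) : ℝ) * (r + 1) = (n + 1) * n.choose r := by
    exact_mod_cast (Nat.add_one_mul_choose_eq n r).symm
  have e2 : ((n + 1).choose r : ℝ) * (n + 1 - r) = (n + 1) * n.choose r := by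
    have h := Nat.choose_mul_succ_eq n r
    have h' : ((n.choose r * (n + 1) : ℕ) : ℝ) = (((n + 1).choose r * (n + 1 - r) : ℕ) : ℝ) := by
      rw [h]
    rw [Nat.cast_mul, Nat.cast_mul, Nat.cast_sub (by omega)] at h'
    push_cast at h'
    linarith
  unfold cotCoeff
  rw [show (r : ℤ) + (d + 1) = r + d + 1 by ring, intChoose_succ_succ,
    show ((r + 1 : ℕ) : ℤ) + d = r + d + 1 by push_cast; ring,
    show 2 * ((r + 1 : ℕ) : ℤ) + d - 1 = 2 * r + d + 1 by push_cast; ring]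
  have hp : (-1 : ℝ) ^ (n + 1 + (r + 1)) = (-1) ^ (n + r) := by
    rw [show n + 1 + (r + 1) = n + r + 2 by ring, pow_add]; norm_num
  have hq : (-1 : ℝ) ^ (n + 1 + r) = -(-1) ^ (n + r) := by
    rw [show n + 1 + r = n + r + 1 by ring, pow_succ]; ring
  rw [hp, hq]
  push_cast
  linear_combination (intChoose M (r + d + 1) * (-1) ^ (n + r) * x ^ (2 * (r : ℤ) + d + 1)) * e1 +
    (intChoose M (r + d) * (-1) ^ (n + r) * x ^ (2 * (r : ℤ) + d + 1)) * e2

theorem succ_mul_spinNorm (l m : ℤ) (n M : ℕ) :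
    (n + 1) * spinNorm l m (n + 1) M =
      Real.sqrt ((n + 1) * (M + 1)) * spinNorm l m n (M + 1) := by
  unfold spinNorm
  rw [← Real.sqrt_mul (by positivity), ← Real.sqrt_sq (show (0 : ℝ) ≤ n + 1 by positivity),
    ← Real.sqrt_mul (by positivity), Real.sqrt_sq (show (0 : ℝ) ≤ n + 1 by positivity)]
  congr 1
  rw [Nat.factorial_succ, Nat.factorial_succ]
  push_cast
  field_simp

/-- **Action of the spin-raising operator on spin-weighted spherical harmonics:**
`ð Y_{s,lm} = √((l-s)(l+s+1)) Y_{s+1,lm}` for `0 < θ < π`. -/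
theorem eth_spinSphHarm
    (s l m : ℤ) (hl : max |s| |s + 1| ≤ l) (hm : |m| ≤ l) :
    ∀ θ φ : ℝ, 0 < θ → θ < Real.pi →
      eth s (spinSphHarm s l m) θ φ =
        ((Real.sqrt (((l : ℝ) - (s : ℝ)) * ((l : ℝ) + (s : ℝ) + 1)) : ℝ) : ℂ) *
          spinSphHarm (s + 1) l m θ φ := by
  intro θ φ h0 hpi
  obtain ⟨h1, h2⟩ := max_le_iff.1 hl
  rw [abs_le] at h1 h2
  obtain ⟨n, hn⟩ := Int.eq_ofNat_of_zero_le (show 0 ≤ l - s - 1 by omega)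
  obtain ⟨M, hM⟩ := Int.eq_ofNat_of_zero_le (show 0 ≤ l + s by omega)
  obtain ⟨L, hL⟩ := Int.eq_ofNat_of_zero_le (show 0 ≤ l by omega)
  have hnR : (l : ℝ) - s = n + 1 := by
    have : l - s = n + 1 := by omega
    exact_mod_cast this
  have hMR : (l : ℝ) + s = M := by exact_mod_cast hM
  have hLR : (l : ℝ) = L := by exact_mod_cast hL
  have hsin : Real.sin θ ≠ 0 := (Real.sin_pos_of_pos_of_lt_pi h0 hpi).ne'
  have hs : Real.sin (θ / 2) ≠ 0 := (Real.sin_pos_of_pos_of_lt_pi (by linarith) (by linarith)).ne'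
  have hc : Real.cos (θ / 2) ≠ 0 := (Real.cos_pos_of_mem_Ioo ⟨by linarith, by linarith⟩).ne'
  have hx : (Real.tan (θ / 2))⁻¹ ≠ 0 := by
    rw [Real.tan_eq_sin_div_cos]; exact inv_ne_zero (div_ne_zero hs hc)
  have hfun : spinSphHarm s l m = fun t p => _ :=
    funext fun t => funext fun p =>
      spinSphHarm_eq_sum (N := n + 1) (by push_cast; omega) hM hL hm t p
  have hderiv := (HasDerivAt.fun_sum (u := Finset.range (n + 1 + 1)) fun r _ =>
    (hasDerivAt_sin_half_pow_mul_inv_tan_half_zpow h0 hpi L (2 * (r : ℤ) + s - m)).const_mul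
      (cotCoeff (n + 1) M (s - m) r)).const_mul (spinNorm l m (n + 1) M)
  have hquot : (s * Real.cos θ + m) / Real.sin θ =
      ((s + m) * (Real.tan (θ / 2))⁻¹ + (m - s) * (Real.tan (θ / 2))⁻¹⁻¹) / 2 := by
    have hd : θ = 2 * (θ / 2) := by ring
    have e1 : Real.cos θ = Real.cos (θ / 2) ^ 2 - Real.sin (θ / 2) ^ 2 := by
      conv_lhs => rw [hd, Real.cos_two_mul']
    have e2 : Real.sin θ = 2 * Real.sin (θ / 2) * Real.cos (θ / 2) := by
      conv_lhs => rw [hd, Real.sin_two_mul]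
    rw [e1, e2, Real.tan_eq_sin_div_cos]
    field_simp
    linear_combination (-(m : ℝ)) * Real.sin_sq_add_cos_sq (θ / 2)
  rw [hfun, eth_mul_exp s m hderiv hsin φ, hquot,
    spinSphHarm_eq_sum (N := n) (M := M + 1) (by omega) (by push_cast; omega) hL hm θ φ]
  refine Eq.trans (congrArg (· * _) ?_) (mul_assoc _ _ _)
  rw [← Complex.ofReal_mul, hnR, hMR, ← mul_assoc (Real.sqrt _), ← succ_mul_spinNorm]
  congr 1
  have hraise := sum_cotCoeff_raise n M (s - m) (Real.tan (θ / 2))⁻¹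
  generalize (Real.tan (θ / 2))⁻¹ = x at hx hraise ⊢
  generalize Real.sin (θ / 2) ^ (2 * L) = S
  have hR : ∑ r ∈ Finset.range (n + 1), cotCoeff n (M + 1) (s + 1 - m) r *
        (S * x ^ (2 * (r : ℤ) + (s + 1) - m)) =
      S * ∑ r ∈ Finset.range (n + 1), cotCoeff n (M + 1) (s - m + 1) r *
        x ^ (2 * (r : ℤ) + (s - m) + 1) := by
    rw [Finset.mul_sum]
    refine Finset.sum_congr rfl fun r _ => ?_
    rw [show s + 1 - m = s - m + 1 by ring,
      show 2 * (r : ℤ) + (s + 1) - m = 2 * r + (s - m) + 1 by ring]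
    ring
  have hL' : -(∑ r ∈ Finset.range (n + 1 + 1), cotCoeff (n + 1) M (s - m) r *
        (S * ((L - ((2 * (r : ℤ) + s - m : ℤ) : ℝ) / 2) * x ^ (2 * (r : ℤ) + s - m + 1) -
          ((2 * (r : ℤ) + s - m : ℤ) : ℝ) / 2 * x ^ (2 * (r : ℤ) + s - m - 1))) -
        ((s + m) * x + (m - s) * x⁻¹) / 2 * ∑ r ∈ Finset.range (n + 1 + 1),
          cotCoeff (n + 1) M (s - m) r * (S * x ^ (2 * (r : ℤ) + s - m))) =
      S * ∑ r ∈ Finset.range (n + 2), cotCoeff (n + 1) M (s - m) r *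
        (r * x ^ (2 * (r : ℤ) + (s - m) - 1) -
          (n + 1 - r) * x ^ (2 * (r : ℤ) + (s - m) + 1)) := by
    rw [Finset.mul_sum, Finset.mul_sum, ← Finset.sum_sub_distrib, ← Finset.sum_neg_distrib]
    refine Finset.sum_congr rfl fun r _ => ?_
    rw [show 2 * (r : ℤ) + (s - m) = 2 * r + s - m by ring, zpow_add_one₀ hx, zpow_sub_one₀ hx]
    push_cast
    rw [← hLR, ← hnR]
    ring
  rw [hR]
  linear_combination spinNorm l m (n + 1) M * hL' + spinNorm l m (n + 1) M * S * hraise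
end
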